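/- arXiv:1602.05717 — 13 statements merged into one kernel-verified Lean document; each statement's English description precedes it below -/
import Mathlib

section
/- Let N > 0, let 0 < a < N and 2/(N+a) < b ≤ 4/(N+3a), and let g ∈ V_{N,a}. Then for every x ∈ [-a/2, 0] one has g(x + 1/b + a) ≤ g(x + 1/b) < g(x + 1/b - a) and g(x + 1/b - a) ≠ 0. -/
open Set

noncomputable section

/-- Second-order difference `Δ²_a f (x) = f x - 2 f (x-a) + f (x-2a)`. -/
def Delta2 (a : ℝ) (f : ℝ → ℝ) (x : ℝ) : ℝ := f x - 2 * f (x - a) + f (x - 2 * a)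

/-- Membership in the class `V_{N,a}` of the paper: `f` is continuous, has support
exactly `[-N/2, N/2]`, is symmetric (A1), strictly increasing on `[-N/2,0]` (A2),
and satisfies the second-order difference condition (A3). -/
def memV (N a : ℝ) (f : ℝ → ℝ) : Prop :=
  Continuous f ∧
  tsupport f = Set.Icc (-(N / 2)) (N / 2) ∧
  (∀ x, f (-x) = f x) ∧
  StrictMonoOn f (Set.Icc (-(N / 2)) 0) ∧
  (a < N / 3 → ∀ x ∈ Set.Icc (-(N / 2)) (-(N / 4) + 3 * a / 4), 0 ≤ Delta2 a f x) ∧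
  (N / 3 ≤ a → (∀ x ∈ Set.Icc (-(N / 2)) 0, 0 ≤ Delta2 a f x) ∧
    0 ≤ Delta2 a f (-(N / 4) + 3 * a / 4))

theorem memV.eq_zero {N a : ℝ} {g : ℝ → ℝ} (hg : memV N a g) {t : ℝ} (ht : N / 2 ≤ t) :
    g t = 0 := by
  obtain ⟨hc, hs, -⟩ := hg
  have hsub : Ioi (N / 2) ⊆ {t | g t = 0} := fun t ht =>
    image_eq_zero_of_notMem_tsupport fun h => (hs ▸ h).2.not_gt ht
  have hcl := closure_minimal hsub (isClosed_eq hc continuous_const)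
  rw [closure_Ioi] at hcl
  exact hcl ht

theorem memV.lt_of_lt {N a : ℝ} {g : ℝ → ℝ} (hg : memV N a g) {s t : ℝ} (hs : 0 ≤ s)
    (hsN : s < N / 2) (hst : s < t) : g t < g s := by
  obtain ⟨-, -, he, hm, -⟩ := id hg
  have key : ∀ u, s < u → u ≤ N / 2 → g u < g s := fun u hsu hu => by
    rw [← he u, ← he s]
    exact hm ⟨by linarith, by linarith⟩ ⟨by linarith, by linarith⟩ (by linarith)
  rcases le_total t (N / 2) with h | h
  · exact key t hst h
  · rw [hg.eq_zero h, ← hg.eq_zero le_rfl]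
    exact key _ hsN le_rfl

theorem memV.le_of_lt {N a : ℝ} {g : ℝ → ℝ} (hg : memV N a g) {s t : ℝ} (hs : 0 ≤ s)
    (hst : s < t) : g t ≤ g s := by
  rcases lt_or_ge s (N / 2) with h | h
  · exact (hg.lt_of_lt hs h hst).le
  · rw [hg.eq_zero h, hg.eq_zero (h.trans hst.le)]

theorem memV.apply_abs {N a : ℝ} {g : ℝ → ℝ} (hg : memV N a g) (t : ℝ) : g |t| = g t := by
  rcases abs_choice t with h | h <;> rw [h]
  exact hg.2.2.1 t

theorem stmt0 (N a b : ℝ) (hN : 0 < N) (ha : 0 < a) (haN : a < N)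
    (hb1 : 2 / (N + a) < b) (hb2 : b ≤ 4 / (N + 3 * a))
    (g : ℝ → ℝ) (hg : memV N a g) :
    ∀ x ∈ Set.Icc (-(a / 2)) 0,
      g (x + 1 / b + a) ≤ g (x + 1 / b) ∧ g (x + 1 / b) < g (x + 1 / b - a) ∧
        g (x + 1 / b - a) ≠ 0 := by
  rintro x ⟨hx1, hx2⟩
  have hb : 0 < b := lt_trans (by positivity) hb1
  have h1 : 1 / b < (N + a) / 2 := by
    rw [div_lt_iff₀ (by positivity)] at hb1
    rw [div_lt_iff₀ hb]
    linarith
  have h2 : (N + 3 * a) / 4 ≤ 1 / b := by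
    rw [le_div_iff₀ (by positivity)] at hb2
    rw [le_div_iff₀ hb]
    linarith
  have habs : |x + 1 / b - a| < N / 2 := abs_lt.2 ⟨by linarith, by linarith⟩
  have habs' : |x + 1 / b - a| < x + 1 / b := abs_lt.2 ⟨by linarith, by linarith⟩
  refine ⟨hg.le_of_lt (by linarith) (by linarith), ?_, ?_⟩
  · rw [← hg.apply_abs (x + 1 / b - a)]
    exact hg.lt_of_lt (abs_nonneg _) habs habs'
  · rw [← hg.apply_abs, ← hg.eq_zero le_rfl]
    exact (hg.lt_of_lt (abs_nonneg _) habs habs).ne'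
end
end

section
/- Let N > 0, let 0 < a < N and 2/(N+a) < b ≤ 4/(N+3a), and let g ∈ V_{N,a}. Then for every x ∈ [-a/2, 0] one has g(x - 1/b - a) ≤ g(x - 1/b) < g(x - 1/b + a) and g(x - 1/b + a) ≠ 0. -/
open Set

noncomputable section

theorem stmt1 (N a b : ℝ) (hN : 0 < N) (ha : 0 < a) (haN : a < N)
    (hb1 : 2 / (N + a) < b) (hb2 : b ≤ 4 / (N + 3 * a))
    (g : ℝ → ℝ) (hg : memV N a g) :
    ∀ x ∈ Set.Icc (-(a / 2)) 0,
      g (x - 1 / b - a) ≤ g (x - 1 / b) ∧ g (x - 1 / b) < g (x - 1 / b + a) ∧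
        g (x - 1 / b + a) ≠ 0 := by
  obtain ⟨hc, hs, -, hm, -, -⟩ := hg
  have hpos : 0 < b := lt_trans (by positivity) hb1
  have hlt : 1 / b < (N + a) / 2 := by
    rw [div_lt_iff₀ (by positivity)] at hb1
    rw [div_lt_iff₀ hpos]
    linarith
  have hge : (N + 3 * a) / 4 ≤ 1 / b := by
    rw [le_div_iff₀ (by positivity)] at hb2
    rw [le_div_iff₀ hpos]
    linarith
  have hzero : ∀ y ≤ -(N / 2), g y = 0 := by
    have hclosed : IsClosed {y | g y = 0} := isClosed_eq hc continuous_const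
    have hsub : Iio (-(N / 2)) ⊆ {y | g y = 0} := fun y hy =>
      image_eq_zero_of_notMem_tsupport (by
        rw [hs]
        exact fun h => absurd h.1 (not_le.mpr hy))
    intro y hy
    refine closure_minimal hsub hclosed ?_
    rwa [closure_Iio]
  have hlt_of_lt : ∀ y z, y < z → -(N / 2) < z → z ≤ 0 → g y < g z := by
    intro y z hyz hz hz0
    rcases le_total y (-(N / 2)) with hy | hy
    · rw [hzero y hy, ← hzero (-(N / 2)) le_rfl]
      exact hm ⟨le_rfl, by linarith⟩ ⟨hz.le, hz0⟩ hz
    · exact hm ⟨hy, by linarith⟩ ⟨hz.le, hz0⟩ hyz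
  rintro x ⟨hx1, hx2⟩
  refine ⟨?_, hlt_of_lt _ _ (by linarith) (by linarith) (by linarith), ?_⟩
  · rcases le_or_gt (x - 1 / b) (-(N / 2)) with h | h
    · rw [hzero _ h, hzero _ (by linarith)]
    · exact (hlt_of_lt _ _ (by linarith) h (by linarith)).le
  · rw [← hzero (-(N / 2)) le_rfl]
    exact (hlt_of_lt _ _ (by linarith) (by linarith) (by linarith)).ne'
end
end

section
/- Let N > 0 and 0 < a < N, and let g ∈ V_{N,a}. Then Δ²_a g(x) ≥ 0 for every x ∈ [-N/2, -N/4 + 3a/4]. -/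
open Set

noncomputable section

/-- A function in the class vanishes to the left of its support, endpoint included. -/
theorem memV.eq_zero_of_le {N a : ℝ} {g : ℝ → ℝ} (hg : memV N a g) {y : ℝ}
    (hy : y ≤ -(N / 2)) : g y = 0 := by
  obtain ⟨hc, hs, -⟩ := hg
  have hsub : Iio (-(N / 2)) ⊆ {x | g x = 0} := fun x hx =>
    image_eq_zero_of_notMem_tsupport (by rw [hs]; exact fun h => not_le_of_gt hx h.1)
  have hcl := closure_minimal hsub (isClosed_eq hc continuous_const)
  rw [closure_Iio] at hcl
  exact hcl hy

/-- A function in the class is monotone on the whole negative half-line. -/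
theorem memV.monotoneOn_Iic {N a : ℝ} {g : ℝ → ℝ} (hN : 0 < N) (hg : memV N a g) :
    MonotoneOn g (Iic 0) := by
  have hm := hg.2.2.2.1.monotoneOn
  intro x _ y hy hxy
  rw [mem_Iic] at hy
  rcases le_total x (-(N / 2)) with hxN | hxN
  · rw [hg.eq_zero_of_le hxN]
    rcases le_total y (-(N / 2)) with hyN | hyN
    · exact (hg.eq_zero_of_le hyN).ge
    · rw [← hg.eq_zero_of_le le_rfl]
      exact hm ⟨le_rfl, by linarith⟩ ⟨hyN, hy⟩ hyN
  · exact hm ⟨hxN, hxy.trans hy⟩ ⟨hxN.trans hxy, hy⟩ hxy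

theorem stmt3 (N a : ℝ) (hN : 0 < N) (ha : 0 < a) (haN : a < N)
    (g : ℝ → ℝ) (hg : memV N a g) :
    ∀ x ∈ Set.Icc (-(N / 2)) (-(N / 4) + 3 * a / 4), 0 ≤ Delta2 a g x := by
  intro x hx
  rcases lt_or_ge a (N / 3) with h | h
  · exact hg.2.2.2.2.1 h x hx
  obtain ⟨hneg, hend⟩ := hg.2.2.2.2.2 h
  rcases le_total x 0 with hx0 | hx0
  · exact hneg x ⟨hx.1, hx0⟩
  have hxc := hx.2
  have hm := hg.monotoneOn_Iic hN
  have h1 : g (-(N / 4) + 3 * a / 4) ≤ g x := by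
    rw [← hg.2.2.1 x, ← hg.2.2.1 (-(N / 4) + 3 * a / 4)]
    exact hm (by rw [mem_Iic]; linarith) (by rw [mem_Iic]; linarith) (by linarith)
  have h2 : g (x - a) ≤ g (-(N / 4) + 3 * a / 4 - a) :=
    hm (by rw [mem_Iic]; linarith) (by rw [mem_Iic]; linarith) (by linarith)
  have h3 : g (x - 2 * a) = 0 := hg.eq_zero_of_le (by linarith)
  have h4 : g (-(N / 4) + 3 * a / 4 - 2 * a) = 0 := hg.eq_zero_of_le (by linarith)
  unfold Delta2 at hend ⊢
  linarith
end
end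

section
/- Let N > 0, let 0 < a < N and 2/(N+a) < b ≤ 4/(N+3a), and let g ∈ V_{N,a}. Then for every x ∈ [-a/2, 0] one has G_{21}(x) ≥ 0, and G_{21}(x) = 0 holds if and only if g(x + 1/b) = 0 and g(x + 1/b + a) = 0. -/
open Set

noncomputable section

/-- The minor `G₂₁` of the matrix `G(x)`. -/
def G21 (g : ℝ → ℝ) (a b x : ℝ) : ℝ :=
  g (x + 1 / b) * g (x - 1 / b + a) - g (x + 1 / b + a) * g (x - 1 / b)

/-- The minor `G₂₂` of the matrix `G(x)`. -/
def G22 (g : ℝ → ℝ) (a b x : ℝ) : ℝ :=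
  g (x + 1 / b - a) * g (x - 1 / b + a) - g (x + 1 / b + a) * g (x - 1 / b - a)

/-- The minor `G₂₃` of the matrix `G(x)`. -/
def G23 (g : ℝ → ℝ) (a b x : ℝ) : ℝ :=
  g (x + 1 / b - a) * g (x - 1 / b) - g (x + 1 / b) * g (x - 1 / b - a)

namespace memV

variable {N a : ℝ} {g : ℝ → ℝ}

theorem eq_zero_of_le_s4 (hg : memV N a g) {y : ℝ} (hy : y ≤ -(N / 2)) : g y = 0 := by
  obtain ⟨hc, hs, -⟩ := hg
  have h : EqOn g (fun _ => 0) (Iio (-(N / 2))) := fun z hz => by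
    refine image_eq_zero_of_notMem_tsupport ?_
    rw [hs]
    exact fun h => absurd h.1 (not_le.mpr hz)
  have h' := h.closure hc continuous_const
  rw [closure_Iio] at h'
  exact h' hy

theorem lt_of_lt_s4 (hN : 0 < N) (hg : memV N a g) {y z : ℝ} (hyz : y < z) (hz : -(N / 2) < z)
    (hz0 : z ≤ 0) : g y < g z := by
  have hmono := hg.2.2.2.1
  rcases le_total y (-(N / 2)) with hy | hy
  · rw [hg.eq_zero_of_le_s4 hy, ← hg.eq_zero_of_le_s4 le_rfl]
    exact hmono ⟨le_rfl, by linarith⟩ ⟨hz.le, hz0⟩ hz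
  · exact hmono ⟨hy, by linarith⟩ ⟨hz.le, hz0⟩ hyz

theorem monotoneOn_Iic_s4 (hN : 0 < N) (hg : memV N a g) : MonotoneOn g (Iic 0) := by
  intro y _ z hz hyz
  rcases le_or_gt z (-(N / 2)) with h | h
  · rw [hg.eq_zero_of_le_s4 h, hg.eq_zero_of_le_s4 (hyz.trans h)]
  · rcases hyz.eq_or_lt with rfl | hlt
    · exact le_rfl
    · exact (hg.lt_of_lt_s4 hN hlt h hz).le

theorem nonneg_of_nonpos (hN : 0 < N) (hg : memV N a g) {y : ℝ} (hy : y ≤ 0) : 0 ≤ g y := by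
  rcases le_or_gt y (-(N / 2)) with h | h
  · exact (hg.eq_zero_of_le_s4 h).ge
  · rw [← hg.eq_zero_of_le_s4 le_rfl]
    exact (hg.lt_of_lt_s4 hN h h hy).le

end memV

theorem stmt4 (N a b : ℝ) (hN : 0 < N) (ha : 0 < a) (haN : a < N)
    (hb1 : 2 / (N + a) < b) (hb2 : b ≤ 4 / (N + 3 * a))
    (g : ℝ → ℝ) (hg : memV N a g) :
    ∀ x ∈ Set.Icc (-(a / 2)) 0,
      0 ≤ G21 g a b x ∧
        (G21 g a b x = 0 ↔ g (x + 1 / b) = 0 ∧ g (x + 1 / b + a) = 0) := by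
  rintro x ⟨hx1, hx2⟩
  have hb : 0 < b := lt_trans (by positivity) hb1
  have hc1 : (N + 3 * a) / 4 ≤ 1 / b := by
    rw [le_div_iff₀ (by positivity)] at hb2
    rw [le_div_iff₀ hb]
    linarith
  have hc2 : 1 / b < (N + a) / 2 := by
    rw [div_lt_iff₀ (by positivity)] at hb1
    rw [div_lt_iff₀ hb]
    linarith
  have hsymm := hg.2.2.1
  unfold G21
  rw [← hsymm (x + 1 / b), ← hsymm (x + 1 / b + a)]
  generalize 1 / b = c at hc1 hc2 ⊢
  have hvu : g (x - c) ≤ g (-(x + c)) :=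
    hg.monotoneOn_Iic_s4 hN (mem_Iic.2 (by linarith)) (mem_Iic.2 (by linarith)) (by linarith)
  have hlow : g (-(x + c + a)) ≤ g (-(x + c)) :=
    hg.monotoneOn_Iic_s4 hN (mem_Iic.2 (by linarith)) (mem_Iic.2 (by linarith)) (by linarith)
  have hlt : g (-(x + c + a)) < g (x - c + a) :=
    hg.lt_of_lt_s4 hN (by linarith) (by linarith) (by linarith)
  have hu : 0 ≤ g (-(x + c)) := hg.nonneg_of_nonpos hN (by linarith)
  have hua : 0 ≤ g (-(x + c + a)) := hg.nonneg_of_nonpos hN (by linarith)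
  have hmul := mul_le_mul_of_nonneg_left hvu hua
  refine ⟨by nlinarith, fun h => ?_, fun ⟨h1, h2⟩ => by rw [h1, h2]; ring⟩
  have hu0 : g (-(x + c)) = 0 := by
    by_contra hne
    nlinarith [mul_lt_mul_of_pos_left hlt (hu.lt_of_ne' hne)]
  exact ⟨hu0, le_antisymm (hlow.trans_eq hu0) hua⟩
end
end

section
/- Let N > 0, let 0 < a < N and 2/(N+a) < b ≤ 4/(N+3a), and let g ∈ V_{N,a}. Then det G(x) ≠ 0 for every x ∈ [-a/2, a/2]. -/
open Set

noncomputable section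

/-- The `3 × 3` matrix `G(x) = (g(x - ℓ/b + m a))_{ℓ, m ∈ {-1,0,1}}`. -/
def Gmat (g : ℝ → ℝ) (a b x : ℝ) : Matrix (Fin 3) (Fin 3) ℝ :=
  !![g (x + 1 / b - a), g (x + 1 / b), g (x + 1 / b + a);
     g (x - a), g x, g (x + a);
     g (x - 1 / b - a), g (x - 1 / b), g (x - 1 / b + a)]

namespace memV

variable {N a : ℝ} {f : ℝ → ℝ}

theorem apply_eq_zero (hf : memV N a f) {t : ℝ} (ht : N / 2 ≤ |t|) : f t = 0 := by
  obtain ⟨hcont, hsupp, heven, -⟩ := hf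
  have hzero : ∀ s ∈ Ioi (N / 2), f s = 0 := fun s hs =>
    image_eq_zero_of_notMem_tsupport fun hmem => by
      rw [hsupp] at hmem
      exact absurd hmem.2 (not_le.mpr hs)
  have hIci : ∀ s ∈ Ici (N / 2), f s = 0 := by
    have hsub : closure (Ioi (N / 2)) ⊆ {s | f s = 0} :=
      closure_minimal hzero (isClosed_eq hcont continuous_const)
    rwa [closure_Ioi] at hsub
  rcases abs_choice t with h | h
  · exact hIci t (h ▸ ht)
  · rw [← heven t]
    exact hIci (-t) (h ▸ ht)

theorem apply_lt_apply (hf : memV N a f) {s t : ℝ} (hs : |s| < N / 2) (hst : |s| < |t|) :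
    f t < f s := by
  have key : ∀ u v : ℝ, |u| < |v| → |v| ≤ N / 2 → f v < f u := by
    intro u v huv hv
    obtain ⟨-, -, heven, hmono, -⟩ := hf
    have habs : ∀ w, f (-|w|) = f w := fun w => by
      rcases abs_choice w with h | h <;> simp [h, heven]
    rw [← habs u, ← habs v]
    have := abs_nonneg u
    exact hmono ⟨by linarith, by linarith⟩ ⟨by linarith, by linarith⟩ (by linarith)
  rcases le_total |t| (N / 2) with ht | ht
  · exact key s t hst ht
  · have hN : |N / 2| = N / 2 := abs_of_nonneg ((abs_nonneg s).trans hs.le)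
    rw [hf.apply_eq_zero ht, ← hf.apply_eq_zero hN.ge]
    exact key s (N / 2) (by rwa [hN]) hN.le

theorem apply_pos (hf : memV N a f) {t : ℝ} (ht : |t| < N / 2) : 0 < f t := by
  have hN : |N / 2| = N / 2 := abs_of_nonneg ((abs_nonneg t).trans ht.le)
  rw [← hf.apply_eq_zero hN.ge]
  exact hf.apply_lt_apply ht (by rwa [hN])

theorem apply_nonneg (hf : memV N a f) (t : ℝ) : 0 ≤ f t := by
  rcases lt_or_ge |t| (N / 2) with ht | ht
  · exact (hf.apply_pos ht).le
  · exact (hf.apply_eq_zero ht).ge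

theorem apply_le_apply (hf : memV N a f) {s t : ℝ} (hst : |s| ≤ |t|) : f t ≤ f s := by
  rcases lt_or_ge |s| (N / 2) with hs | hs
  · rcases hst.lt_or_eq with h | h
    · exact (hf.apply_lt_apply hs h).le
    · rcases abs_eq_abs.mp h with h | h
      · rw [h]
      · rw [h, hf.2.2.1]
  · rw [hf.apply_eq_zero hs, hf.apply_eq_zero (hs.trans hst)]

theorem two_mul_apply_le (hf : memV N a f) (haN : a < N / 3) {s : ℝ} (hs : (N + a) / 4 ≤ s)
    (hs' : s ≤ N / 2 + a) : 2 * f s ≤ f (s - a) + f (s + a) := by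
  have h := hf.2.2.2.2.1 haN (a - s) ⟨by linarith, by linarith⟩
  rw [Delta2, show a - s = -(s - a) by ring, show -(s - a) - a = -s by ring,
    show -(s - a) - 2 * a = -(s + a) by ring, hf.2.2.1, hf.2.2.1, hf.2.2.1] at h
  linarith

end memV

/-- A `3 × 3` determinant is positive when its outer rows are nonnegative, monotone in opposite
directions and convex, while its middle row is largest in the middle. -/
theorem det_pos_of_convex_rows {a₁ a₂ a₃ b₁ b₂ b₃ c₁ c₂ c₃ : ℝ}
    (ha₃ : 0 ≤ a₃) (ha₂₃ : a₃ ≤ a₂) (ha₁₂ : a₂ < a₁) (ha : 2 * a₂ ≤ a₁ + a₃)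
    (hc₁ : 0 ≤ c₁) (hc₁₂ : c₁ ≤ c₂) (hc₂₃ : c₂ < c₃) (hc : 2 * c₂ ≤ c₁ + c₃)
    (hb₂ : 0 < b₂) (hb₁₂ : b₁ ≤ b₂) (hb₃₂ : b₃ < b₂) :
    0 < (!![a₁, a₂, a₃; b₁, b₂, b₃; c₁, c₂, c₃] : Matrix (Fin 3) (Fin 3) ℝ).det := by
  have hdet : (!![a₁, a₂, a₃; b₁, b₂, b₃; c₁, c₂, c₃] : Matrix (Fin 3) (Fin 3) ℝ).det =
      b₂ * ((a₁ - a₂) * (c₃ - c₂) - (a₂ - a₃) * (c₂ - c₁)) +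
        (b₂ - b₁) * (a₂ * c₃ - a₃ * c₂) + (b₂ - b₃) * (a₁ * c₂ - a₂ * c₁) := by
    simp [Matrix.det_fin_three]
    ring
  have hleft : 0 ≤ a₂ * c₃ - a₃ * c₂ :=
    sub_nonneg.mpr (mul_le_mul ha₂₃ hc₂₃.le (by linarith) (by linarith))
  have hright : 0 ≤ a₁ * c₂ - a₂ * c₁ :=
    sub_nonneg.mpr (mul_le_mul ha₁₂.le hc₁₂ hc₁ (by linarith))
  have hleft' := mul_nonneg (sub_nonneg.mpr hb₁₂) hleft
  have hmid : (a₂ - a₃) * (c₂ - c₁) ≤ (a₁ - a₂) * (c₂ - c₁) :=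
    mul_le_mul_of_nonneg_right (by linarith) (by linarith)
  rw [hdet]
  rcases hc.lt_or_eq with h | h
  · have hmid' : (a₁ - a₂) * (c₂ - c₁) < (a₁ - a₂) * (c₃ - c₂) :=
      mul_lt_mul_of_pos_left (by linarith) (by linarith)
    have := mul_pos hb₂ (sub_pos.mpr (hmid.trans_lt hmid'))
    have := mul_nonneg (sub_nonneg.mpr hb₃₂.le) hright
    linarith
  · have hmid' : (a₁ - a₂) * (c₂ - c₁) ≤ (a₁ - a₂) * (c₃ - c₂) :=
      mul_le_mul_of_nonneg_left (by linarith) (by linarith)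
    have hc₂ : 0 < c₂ := by linarith
    have hlow : a₂ * c₁ ≤ a₂ * c₂ := mul_le_mul_of_nonneg_left hc₁₂ (by linarith)
    have hhigh : a₂ * c₂ < a₁ * c₂ := mul_lt_mul_of_pos_right ha₁₂ hc₂
    have := mul_nonneg hb₂.le (sub_nonneg.mpr (hmid.trans hmid'))
    have := mul_pos (sub_pos.mpr hb₃₂) (sub_pos.mpr (hlow.trans_lt hhigh))
    linarith

theorem det_Gmat_neg {g : ℝ → ℝ} (hg : ∀ x, g (-x) = g x) (a b x : ℝ) :
    (Gmat g a b (-x)).det = (Gmat g a b x).det := by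
  have hreflect : ∀ u v, u + v = 0 → g u = g v := fun u v huv => by
    rw [eq_neg_of_add_eq_zero_left huv, hg]
  rw [Gmat, Gmat, hreflect (-x + 1 / b - a) (x - 1 / b + a) (by ring),
    hreflect (-x + 1 / b) (x - 1 / b) (by ring),
    hreflect (-x + 1 / b + a) (x - 1 / b - a) (by ring),
    hreflect (-x - a) (x + a) (by ring), hg x, hreflect (-x + a) (x - a) (by ring),
    hreflect (-x - 1 / b - a) (x + 1 / b + a) (by ring),
    hreflect (-x - 1 / b) (x + 1 / b) (by ring),
    hreflect (-x - 1 / b + a) (x + 1 / b - a) (by ring)]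
  simp only [Matrix.det_fin_three, Matrix.of_apply, Matrix.cons_val]
  ring

theorem det_Gmat_pos {N a b : ℝ} (ha : 0 < a) (hlow : (N + 3 * a) / 4 ≤ 1 / b)
    (hupp : 1 / b < (N + a) / 2) {g : ℝ → ℝ} (hg : memV N a g) {x : ℝ} (hx₀ : 0 ≤ x)
    (hx : x ≤ a / 2) : 0 < (Gmat g a b x).det := by
  have heven := hg.2.2.1
  rw [Gmat]
  generalize 1 / b = c at hlow hupp
  have hx_abs : |x| = x := abs_of_nonneg hx₀
  have hxa_abs : |x - a| = a - x := by rw [abs_sub_comm, abs_of_nonneg (by linarith)]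
  have hxa_abs' : |x + a| = x + a := abs_of_nonneg (by linarith)
  have hxc_abs : |x + c| = x + c := abs_of_nonneg (by linarith)
  have hxc_abs' : |x - c| = c - x := by rw [abs_sub_comm, abs_of_nonneg (by linarith)]
  have hb₂ : 0 < g x := hg.apply_pos (by linarith)
  have hb₁₂ : g (x - a) ≤ g x := hg.apply_le_apply (by linarith)
  have hb₃₂ : g (x + a) < g x := hg.apply_lt_apply (by linarith) (by linarith)
  have htop_abs : |x + c - a| < N / 2 := abs_lt.mpr ⟨by linarith, by linarith⟩
  have hbot_abs : |x - c + a| < N / 2 := abs_lt.mpr ⟨by linarith, by linarith⟩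
  have ha₁₂ : g (x + c) < g (x + c - a) :=
    hg.apply_lt_apply htop_abs (abs_lt.mpr ⟨by linarith, by linarith⟩)
  have hc₂₃ : g (x - c) < g (x - c + a) :=
    hg.apply_lt_apply hbot_abs (abs_lt.mpr ⟨by linarith, by linarith⟩)
  rcases lt_or_ge a (N / 3) with h | h
  · refine det_pos_of_convex_rows (hg.apply_nonneg _) (hg.apply_le_apply ?_) ha₁₂ ?_
      (hg.apply_nonneg _) (hg.apply_le_apply ?_) hc₂₃ ?_ hb₂ hb₁₂ hb₃₂
    · rw [hxc_abs]
      exact le_trans (by linarith) (le_abs_self _)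
    · exact hg.two_mul_apply_le h (by linarith) (by linarith)
    · rw [hxc_abs']
      exact le_trans (by linarith) (neg_le_abs _)
    · have := hg.two_mul_apply_le h (s := c - x) (by linarith) (by linarith)
      rwa [← heven (c - x), ← heven (c - x - a), ← heven (c - x + a),
        show -(c - x) = x - c by ring, show -(c - x - a) = x - c + a by ring,
        show -(c - x + a) = x - c - a by ring, add_comm] at this
  · have ha₂ : g (x + c) = 0 := hg.apply_eq_zero (by linarith)
    have ha₃ : g (x + c + a) = 0 := hg.apply_eq_zero (le_trans (by linarith) (le_abs_self _))
    have hdet : (!![g (x + c - a), g (x + c), g (x + c + a); g (x - a), g x, g (x + a);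
        g (x - c - a), g (x - c), g (x - c + a)] : Matrix (Fin 3) (Fin 3) ℝ).det =
        g (x + c - a) * (g x * g (x - c + a) - g (x + a) * g (x - c)) := by
      simp [Matrix.det_fin_three, ha₂, ha₃]
      ring
    rw [hdet]
    exact mul_pos (hg.apply_pos htop_abs) (sub_pos.mpr
      (mul_lt_mul'' hb₃₂ hc₂₃ (hg.apply_nonneg _) (hg.apply_nonneg _)))

theorem stmt7 (N a b : ℝ) (hN : 0 < N) (ha : 0 < a) (haN : a < N)
    (hb1 : 2 / (N + a) < b) (hb2 : b ≤ 4 / (N + 3 * a))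
    (g : ℝ → ℝ) (hg : memV N a g) :
    ∀ x ∈ Set.Icc (-(a / 2)) (a / 2), (Gmat g a b x).det ≠ 0 := by
  intro x hx
  have hb : 0 < b := lt_trans (by positivity) hb1
  have hlow : (N + 3 * a) / 4 ≤ 1 / b := by
    rw [le_div_iff₀ (by positivity)] at hb2
    rw [le_div_iff₀ hb]
    linarith
  have hupp : 1 / b < (N + a) / 2 := by
    rw [div_lt_iff₀ (by positivity)] at hb1
    rw [div_lt_iff₀ hb]
    linarith
  rcases le_total 0 x with h | h
  · exact (det_Gmat_pos ha hlow hupp hg h hx.2).ne'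
  · rw [← det_Gmat_neg hg.2.2.1]
    exact (det_Gmat_pos ha hlow hupp hg (neg_nonneg.mpr h) (by linarith [hx.1])).ne'
end
end

section
/- Let N > 0 and let g : ℝ → ℝ be continuous with support exactly [-N/2, N/2], with g(-x) = g(x) for all x ∈ ℝ and g strictly increasing on [-N/2, 0]. Assume there is a locally integrable function φ : ℝ → ℝ such that g(y) - g(x) = ∫_x^y φ(t) dt for all x, y ∈ ℝ, where φ is monotone increasing on (-N/2, -N/4] and φ(-x - N/2) ≤ φ(x) for all x ∈ [-N/4, 0). Then for every a ∈ (0, N) and every x ∈ [-N/2, -N/4 + 3a/4] one has Δ²_a g(x) ≥ 0; consequently g ∈ V_{N,a} for every a ∈ (0, N). -/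
open Set

noncomputable section

/-- A continuous function with topological support `[l, u]` vanishes on `(-∞, l]`. -/
theorem eq_zero_of_le_of_tsupport {g : ℝ → ℝ} {l u : ℝ} (hcont : Continuous g)
    (hsupp : tsupport g = Set.Icc l u) {x : ℝ} (hx : x ≤ l) : g x = 0 := by
  have hclosed : IsClosed {y | g y = 0} := isClosed_eq hcont continuous_const
  have hsub : Set.Iio l ⊆ {y | g y = 0} := fun y hy ↦
    image_eq_zero_of_notMem_tsupport fun hmem ↦ by
      rw [hsupp] at hmem
      exact absurd hmem.1 (not_le.2 hy)
  have := hclosed.closure_subset_iff.2 hsub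
  rw [closure_Iio] at this
  exact this hx

/-- If a density of `g` at each point of `(m, m + b)` dominates the density at the mirror image
about `m`, then `g` satisfies the midpoint inequality at `m`. -/
theorem two_mul_le_add_of_density_reflect_le {g φ : ℝ → ℝ} {m b : ℝ}
    (hφ : MeasureTheory.LocallyIntegrable φ)
    (hftc : ∀ x y : ℝ, g y - g x = ∫ t in x..y, φ t) (hb : 0 ≤ b)
    (hle : ∀ t ∈ Set.Ioo m (m + b), φ (2 * m - t) ≤ φ t) :
    2 * g m ≤ g (m + b) + g (m - b) := by
  have hint : ∀ x y : ℝ, IntervalIntegrable φ MeasureTheory.volume x y :=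
    fun x y ↦ (hφ.integrableOn_isCompact isCompact_uIcc).intervalIntegrable
  have hrefl : ∫ t in m..(m + b), φ (2 * m - t) = ∫ t in (m - b)..m, φ t := by
    rw [intervalIntegral.integral_comp_sub_left (fun t ↦ φ t)]
    congr 1 <;> ring
  have hint' : IntervalIntegrable (fun t ↦ φ (2 * m - t)) MeasureTheory.volume m (m + b) := by
    have h := (hint (m - b) m).comp_sub_left (2 * m)
    rw [show 2 * m - (m - b) = m + b by ring, show 2 * m - m = m by ring] at h
    exact h.symm
  have hmono := intervalIntegral.integral_mono_on_of_le_Ioo (by linarith) hint'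
    (hint m (m + b)) hle
  rw [hrefl, ← hftc, ← hftc] at hmono
  linarith

theorem stmt11 (N : ℝ) (hN : 0 < N) (g : ℝ → ℝ)
    (hcont : Continuous g) (hsupp : tsupport g = Set.Icc (-(N / 2)) (N / 2))
    (hsym : ∀ x : ℝ, g (-x) = g x)
    (hmono : StrictMonoOn g (Set.Icc (-(N / 2)) 0))
    (φ : ℝ → ℝ) (hloc : MeasureTheory.LocallyIntegrable φ)
    (hftc : ∀ x y : ℝ, g y - g x = ∫ t in x..y, φ t)
    (hφmono : MonotoneOn φ (Set.Ioc (-(N / 2)) (-(N / 4))))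
    (hφineq : ∀ x ∈ Set.Ico (-(N / 4)) (0 : ℝ), φ (-x - N / 2) ≤ φ x) :
    ∀ a ∈ Set.Ioo (0 : ℝ) N,
      (∀ x ∈ Set.Icc (-(N / 2)) (-(N / 4) + 3 * a / 4), 0 ≤ Delta2 a g x) ∧
        memV N a g := by
  have hzero : ∀ x ≤ -(N / 2), g x = 0 := fun x hx ↦ eq_zero_of_le_of_tsupport hcont hsupp hx
  have hle : ∀ x y, -(N / 2) ≤ x → x ≤ y → y ≤ 0 → g x ≤ g y := fun x y hx hxy hy ↦
    hmono.monotoneOn ⟨hx, hxy.trans hy⟩ ⟨hx.trans hxy, hy⟩ hxy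
  have hnonneg_left : ∀ x ≤ 0, 0 ≤ g x := by
    intro x hx
    rcases le_total x (-(N / 2)) with h | h
    · exact (hzero x h).ge
    · exact (hzero _ le_rfl).symm.trans_le (hle _ x le_rfl h hx)
  have hnonneg : ∀ x, 0 ≤ g x := by
    intro x
    rcases le_total x 0 with h | h
    · exact hnonneg_left x h
    · exact (hnonneg_left (-x) (by linarith)).trans_eq (hsym x)
  have hmid : ∀ m b, m ≤ -(N / 4) → 0 ≤ b → b ≤ m + N / 2 →
      2 * g m ≤ g (m + b) + g (m - b) := by
    intro m b hm hb hbm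
    refine two_mul_le_add_of_density_reflect_le hloc hftc hb fun t ht ↦ ?_
    have h1 := ht.1
    have h2 := ht.2
    rcases le_total t (-(N / 4)) with h | h
    · exact hφmono ⟨by linarith, by linarith⟩ ⟨by linarith, h⟩ (by linarith)
    · exact (hφmono ⟨by linarith, by linarith⟩ ⟨by linarith, by linarith⟩
        (by linarith)).trans (hφineq t ⟨h, by linarith⟩)
  have hdouble : ∀ m z, m ≤ -(N / 4) → 2 * m + N / 2 ≤ z → z ≤ 0 → 2 * g m ≤ g z := by
    intro m z hm hmz hz
    rcases le_total m (-(N / 2)) with h | h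
    · rw [hzero m h, mul_zero]
      exact hnonneg z
    · have h1 := hmid m (m + N / 2) hm (by linarith) le_rfl
      have h2 := hzero (m - (m + N / 2)) (by linarith)
      have h3 := hle (m + (m + N / 2)) z (by linarith) (by linarith) hz
      linarith
  intro a ha
  have ha0 := ha.1
  have haN := ha.2
  have key : ∀ x ∈ Set.Icc (-(N / 2)) (-(N / 4) + 3 * a / 4), 0 ≤ Delta2 a g x := by
    intro x hx
    have hx1 := hx.1
    have hx2 := hx.2
    unfold Delta2
    rcases le_total x 0 with h0 | h0
    · rcases le_total a (x - a + N / 2) with h | h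
      · have h1 := hmid (x - a) a (by linarith) ha0.le h
        rw [show x - a + a = x by ring, show x - a - a = x - 2 * a by ring] at h1
        linarith
      · have h1 := hdouble (x - a) x (by linarith) (by linarith) h0
        have h2 := hnonneg (x - 2 * a)
        linarith
    · have h1 := hdouble (x - a) (-x) (by linarith) (by linarith) (by linarith)
      rw [hsym] at h1
      have h2 := hnonneg (x - 2 * a)
      linarith
  refine ⟨key, hcont, hsupp, hsym, hmono, fun _ ↦ key, fun h ↦ ⟨fun x hx ↦ ?_, ?_⟩⟩
  · exact key x ⟨hx.1, hx.2.trans (by linarith)⟩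
  · exact key _ ⟨by linarith, le_rfl⟩
end
end

section
/- Let N > 0 and let g : ℝ → ℝ be continuous with support exactly [-N/2, N/2], with g(-x) = g(x) for all x ∈ ℝ. Assume there is a locally integrable function φ : ℝ → ℝ such that g(y) - g(x) = ∫_x^y φ(t) dt for all x, y ∈ ℝ, where φ is positive and monotone increasing on (-N/2, 0). Then g is strictly increasing on [-N/2, 0], and for every a ∈ (0, N) and every x ∈ [-N/2, -N/4 + 3a/4] one has Δ²_a g(x) ≥ 0; consequently g ∈ V_{N,a} for every a ∈ (0, N). -/
open Set

noncomputable section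

/-- A locally integrable function on `ℝ` is interval integrable on every interval. -/
theorem MeasureTheory.LocallyIntegrable.intervalIntegrable_volume {φ : ℝ → ℝ}
    (hφ : MeasureTheory.LocallyIntegrable φ) (a b : ℝ) :
    IntervalIntegrable φ MeasureTheory.volume a b :=
  intervalIntegrable_iff.2 <|
    (hφ.integrableOn_isCompact isCompact_uIcc).mono_set Set.uIoc_subset_uIcc

/-- A continuous function with topological support `[a, b]` vanishes off `(a, b)`. -/
theorem eq_zero_of_notMem_Ioo_of_tsupport_eq_Icc {f : ℝ → ℝ} {a b x : ℝ} (hf : Continuous f)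
    (hsupp : tsupport f = Set.Icc a b) (hx : x ∉ Set.Ioo a b) : f x = 0 := by
  by_contra h
  have hsub : Function.support f ⊆ interior (Set.Icc a b) :=
    interior_maximal (hsupp ▸ subset_tsupport f) hf.isOpen_support
  rw [interior_Icc] at hsub
  exact hx (hsub h)

/-- A primitive of a function which is positive on `(a, b)` is strictly increasing on `[a, b]`. -/
theorem strictMonoOn_of_integral_pos {g φ : ℝ → ℝ} {a b : ℝ}
    (hloc : MeasureTheory.LocallyIntegrable φ)
    (hftc : ∀ x y : ℝ, g y - g x = ∫ t in x..y, φ t)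
    (hpos : ∀ x ∈ Set.Ioo a b, 0 < φ x) : StrictMonoOn g (Set.Icc a b) := by
  intro x hx y hy hxy
  rw [← sub_pos, hftc x y]
  exact intervalIntegral.intervalIntegral_pos_of_pos_on (hloc.intervalIntegrable_volume _ _)
    (fun t ht => hpos t ⟨hx.1.trans_lt ht.1, ht.2.trans_le hy.2⟩) hxy

/-- A primitive of a function which is monotone on `(a, b)` is midpoint convex on `[a, b]`. -/
theorem two_mul_le_add_of_integral_monotoneOn {g φ : ℝ → ℝ} {a b m d : ℝ}
    (hloc : MeasureTheory.LocallyIntegrable φ)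
    (hftc : ∀ x y : ℝ, g y - g x = ∫ t in x..y, φ t)
    (hmono : MonotoneOn φ (Set.Ioo a b)) (hd : 0 ≤ d) (ha : a ≤ m - d) (hb : m + d ≤ b) :
    2 * g m ≤ g (m - d) + g (m + d) := by
  have hshift : ∫ t in m..(m + d), φ (t - d) = ∫ t in (m - d)..m, φ t := by
    rw [intervalIntegral.integral_comp_sub_right, add_sub_cancel_right]
  have hint : IntervalIntegrable (fun t => φ (t - d)) MeasureTheory.volume m (m + d) := by
    simpa using (hloc.intervalIntegrable_volume (m - d) m).comp_sub_right d
  have hle : ∫ t in m..(m + d), φ (t - d) ≤ ∫ t in m..(m + d), φ t := by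
    refine intervalIntegral.integral_mono_on_of_le_Ioo (by linarith) hint
      (hloc.intervalIntegrable_volume _ _) fun t ht => ?_
    exact hmono ⟨by linarith [ht.1], by linarith [ht.2]⟩
      ⟨by linarith [ht.1], by linarith [ht.2]⟩ (by linarith)
  rw [hshift, ← hftc, ← hftc] at hle
  linarith

theorem stmt12 (N : ℝ) (hN : 0 < N) (g : ℝ → ℝ)
    (hcont : Continuous g) (hsupp : tsupport g = Set.Icc (-(N / 2)) (N / 2))
    (hsym : ∀ x : ℝ, g (-x) = g x)
    (φ : ℝ → ℝ) (hloc : MeasureTheory.LocallyIntegrable φ)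
    (hftc : ∀ x y : ℝ, g y - g x = ∫ t in x..y, φ t)
    (hφpos : ∀ x ∈ Set.Ioo (-(N / 2)) (0 : ℝ), 0 < φ x)
    (hφmono : MonotoneOn φ (Set.Ioo (-(N / 2)) (0 : ℝ))) :
    StrictMonoOn g (Set.Icc (-(N / 2)) 0) ∧
    ∀ a ∈ Set.Ioo (0 : ℝ) N,
      (∀ x ∈ Set.Icc (-(N / 2)) (-(N / 4) + 3 * a / 4), 0 ≤ Delta2 a g x) ∧
        memV N a g := by
  have hmono : StrictMonoOn g (Set.Icc (-(N / 2)) 0) :=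
    strictMonoOn_of_integral_pos hloc hftc hφpos
  have hzero : ∀ x ≤ -(N / 2), g x = 0 := fun x hx =>
    eq_zero_of_notMem_Ioo_of_tsupport_eq_Icc hcont hsupp fun h => absurd h.1 (not_lt.2 hx)
  have hle : ∀ x y, x ≤ y → y ≤ 0 → g x ≤ g y := by
    intro x y hxy hy
    rcases le_total (-(N / 2)) x with hx | hx
    · exact hmono.monotoneOn ⟨hx, hxy.trans hy⟩ ⟨hx.trans hxy, hy⟩ hxy
    · rw [hzero x hx]
      rcases le_total (-(N / 2)) y with hy' | hy'
      · rw [← hzero _ le_rfl]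
        exact hmono.monotoneOn ⟨le_rfl, hy'.trans hy⟩ ⟨hy', hy⟩ hy'
      · exact (hzero y hy').ge
  have hmid : ∀ m d, 0 ≤ d → m + d ≤ 0 → 2 * g m ≤ g (m - d) + g (m + d) := by
    intro m d hd hmd
    rcases le_total (-(N / 2)) (m - d) with h | h
    · exact two_mul_le_add_of_integral_monotoneOn hloc hftc hφmono hd h hmd
    · rcases le_total (-(N / 2)) m with hm | hm
      · have hconv := two_mul_le_add_of_integral_monotoneOn (m := m) (d := m + N / 2)
          hloc hftc hφmono (by linarith) (by linarith) (by linarith)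
        have h₁ := hle (m + (m + N / 2)) (m + d) (by linarith) hmd
        rw [hzero (m - (m + N / 2)) (by linarith)] at hconv
        rw [hzero (m - d) h]
        linarith
      · have h₁ := hle m (m + d) (by linarith) hmd
        rw [hzero m hm] at h₁ ⊢
        rw [hzero (m - d) h]
        linarith
  have hdelta : ∀ a ∈ Set.Ioo (0 : ℝ) N,
      ∀ x ≤ -(N / 4) + 3 * a / 4, 0 ≤ Delta2 a g x := by
    rintro a ⟨ha, haN⟩ x hx
    unfold Delta2
    rcases le_total x 0 with hx0 | hx0
    · have h := hmid (x - a) a ha.le (by linarith)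
      rw [sub_add_cancel, sub_sub, ← two_mul] at h
      linarith
    · have hconv := hmid ((-x - N / 2) / 2) ((N / 2 - x) / 2) (by linarith) (by linarith)
      have h₁ := hle (x - a) ((-x - N / 2) / 2) (by linarith) (by linarith)
      rw [hzero ((-x - N / 2) / 2 - (N / 2 - x) / 2) (by linarith),
        show (-x - N / 2) / 2 + (N / 2 - x) / 2 = -x by ring, hsym] at hconv
      rw [hzero (x - 2 * a) (by linarith)]
      linarith
  refine ⟨hmono, fun a ha => ⟨fun x hx => hdelta a ha x hx.2, hcont, hsupp, hsym, hmono,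
    fun _ x hx => hdelta a ha x hx.2, fun haN => ⟨fun x hx => ?_, hdelta a ha _ le_rfl⟩⟩⟩
  exact hdelta a ha x (by linarith [hx.2])
end
end

section
/- Let N be an integer with N ≥ 2 and let B_N be the B-spline of order N. Then B_N is continuous with support exactly [-N/2, N/2], B_N(-x) = B_N(x) for all x ∈ ℝ, B_N is strictly increasing on [-N/2, 0], and for every a ∈ (0, N) and every x ∈ [-N/2, -N/4 + 3a/4] one has Δ²_a B_N(x) ≥ 0; consequently B_N ∈ V_{N,a} for every a ∈ (0, N). -/
open Set

noncomputable section

/-- The B-splines, defined recursively: `B₁ = χ_{[-1/2,1/2]}`, `B_{N+1} = B_N * B₁`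
(convolution). The value at index `0` is irrelevant. -/
def Bspline : ℕ → ℝ → ℝ
  | 0 => fun _ => 0
  | 1 => fun x => if x ∈ Set.Icc (-(1 / 2) : ℝ) (1 / 2) then 1 else 0
  | (n + 2) => fun x => ∫ t : ℝ, Bspline (n + 1) (x - t) * Bspline 1 t

/-- The sliding unit-window integral of `k`, that is, its convolution with `Bspline 1`. -/
def windowIntegral (k : ℝ → ℝ) (x : ℝ) : ℝ := ∫ t in (x - 1 / 2)..(x + 1 / 2), k t

/-- The central difference of `k` with unit step. -/
def centralDiff (k : ℝ → ℝ) (x : ℝ) : ℝ := k (x + 1 / 2) - k (x - 1 / 2)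

/-- Even unimodal functions supported in `[-r, r]` whose central difference is positive
on `(-(r + 1/2), 0)` and leans towards the origin. -/
structure IsBell (r : ℝ) (k : ℝ → ℝ) : Prop where
  intervalIntegrable : ∀ a b, IntervalIntegrable k MeasureTheory.volume a b
  even : ∀ x, k (-x) = k x
  le_of_abs_le : ∀ x y, |x| ≤ |y| → k y ≤ k x
  eq_zero : ∀ x, r < |x| → k x = 0
  pos : ∀ x, |x| < r → 0 < k x
  centralDiff_pos : ∀ s, -(r + 1 / 2) < s → s < 0 → 0 < centralDiff k s
  centralDiff_le : ∀ x y, y ≤ x → x < 0 → x + y ≤ -(r + 1 / 2) →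
    centralDiff k y ≤ centralDiff k x

namespace IsBell

variable {r : ℝ} {k : ℝ → ℝ}

lemma intervalIntegrable_centralDiff (h : IsBell r k) (a b : ℝ) :
    IntervalIntegrable (centralDiff k) MeasureTheory.volume a b := by
  have h1 := (h.intervalIntegrable (a + 1 / 2) (b + 1 / 2)).comp_add_right (1 / 2)
  have h2 := (h.intervalIntegrable (a - 1 / 2) (b - 1 / 2)).comp_sub_right (1 / 2)
  simp only [add_sub_cancel_right, sub_add_cancel] at h1 h2
  exact h1.sub h2

lemma centralDiff_neg (h : IsBell r k) (x : ℝ) : centralDiff k (-x) = -centralDiff k x := by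
  have h1 := h.even (x - 1 / 2)
  have h2 := h.even (x + 1 / 2)
  have e1 : -x + 1 / 2 = -(x - 1 / 2) := by ring
  have e2 : -x - 1 / 2 = -(x + 1 / 2) := by ring
  rw [centralDiff, centralDiff, e1, e2, h1, h2]
  ring

lemma centralDiff_nonneg (h : IsBell r k) {s : ℝ} (hs : s ≤ 0) : 0 ≤ centralDiff k s := by
  refine sub_nonneg.2 (h.le_of_abs_le _ _ ?_)
  rw [abs_of_nonpos (by linarith : s - 1 / 2 ≤ 0), abs_le]
  constructor <;> linarith

lemma centralDiff_eq_zero (h : IsBell r k) {s : ℝ} (hs : s < -(r + 1 / 2)) :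
    centralDiff k s = 0 := by
  rw [centralDiff, h.eq_zero, h.eq_zero, sub_zero] <;>
  · rw [lt_abs]
    right
    linarith

lemma windowIntegral_sub (h : IsBell r k) (x y : ℝ) :
    windowIntegral k y - windowIntegral k x = ∫ s in x..y, centralDiff k s := by
  have i := h.intervalIntegrable
  have h1 := (h.intervalIntegrable (x + 1 / 2) (y + 1 / 2)).comp_add_right (1 / 2)
  have h2 := (h.intervalIntegrable (x - 1 / 2) (y - 1 / 2)).comp_sub_right (1 / 2)
  simp only [add_sub_cancel_right, sub_add_cancel] at h1 h2
  unfold centralDiff windowIntegral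
  rw [intervalIntegral.integral_sub h1 h2, intervalIntegral.integral_comp_add_right,
    intervalIntegral.integral_comp_sub_right]
  have e1 := intervalIntegral.integral_add_adjacent_intervals
    (i (x - 1 / 2) (x + 1 / 2)) (i (x + 1 / 2) (y + 1 / 2))
  have e2 := intervalIntegral.integral_add_adjacent_intervals
    (i (x - 1 / 2) (y - 1 / 2)) (i (y - 1 / 2) (y + 1 / 2))
  linarith

lemma continuous_windowIntegral (h : IsBell r k) : Continuous (windowIntegral k) := by
  have hc := intervalIntegral.continuous_primitive h.intervalIntegrable 0
  have e : windowIntegral k =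
      fun x => (∫ t in (0 : ℝ)..(x + 1 / 2), k t) - ∫ t in (0 : ℝ)..(x - 1 / 2), k t := by
    funext x
    rw [intervalIntegral.integral_interval_sub_left (h.intervalIntegrable _ _)
      (h.intervalIntegrable _ _)]
    rfl
  rw [e]
  exact (hc.comp (by fun_prop)).sub (hc.comp (by fun_prop))

lemma windowIntegral_neg (h : IsBell r k) (x : ℝ) :
    windowIntegral k (-x) = windowIntegral k x := by
  have e := intervalIntegral.integral_comp_neg (a := x - 1 / 2) (b := x + 1 / 2) k
  simp only [h.even] at e
  rw [windowIntegral, windowIntegral, e]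
  congr 1 <;> ring

lemma strictMonoOn_windowIntegral (h : IsBell r k) :
    StrictMonoOn (windowIntegral k) (Icc (-(r + 1 / 2)) 0) := by
  intro x hx y hy hxy
  rw [← sub_pos, h.windowIntegral_sub]
  exact intervalIntegral.intervalIntegral_pos_of_pos_on (h.intervalIntegrable_centralDiff _ _)
    (fun s hs => h.centralDiff_pos s (hx.1.trans_lt hs.1) (hs.2.trans_le hy.2)) hxy

lemma monotoneOn_windowIntegral (h : IsBell r k) :
    MonotoneOn (windowIntegral k) (Iic 0) := by
  intro x hx y hy hxy
  rw [← sub_nonneg, h.windowIntegral_sub]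
  exact intervalIntegral.integral_nonneg hxy
    (fun s hs => h.centralDiff_nonneg (hs.2.trans hy))

lemma windowIntegral_neg_abs (h : IsBell r k) (x : ℝ) :
    windowIntegral k (-|x|) = windowIntegral k x := by
  rcases abs_choice x with e | e <;> rw [e]
  · exact h.windowIntegral_neg x
  · rw [neg_neg]

lemma windowIntegral_le_of_abs_le (h : IsBell r k) (x y : ℝ) (hxy : |x| ≤ |y|) :
    windowIntegral k y ≤ windowIntegral k x := by
  rw [← h.windowIntegral_neg_abs x, ← h.windowIntegral_neg_abs y]
  exact h.monotoneOn_windowIntegral (by simp) (by simp) (neg_le_neg hxy)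

lemma windowIntegral_eq_zero (h : IsBell r k) (x : ℝ) (hx : r + 1 / 2 ≤ |x|) :
    windowIntegral k x = 0 := by
  rw [← h.windowIntegral_neg_abs, windowIntegral,
    intervalIntegral.integral_of_le (by linarith), MeasureTheory.integral_Ioc_eq_integral_Ioo]
  refine MeasureTheory.setIntegral_eq_zero_of_forall_eq_zero fun t ht => h.eq_zero t ?_
  rw [lt_abs]
  right
  linarith [ht.2]

lemma windowIntegral_pos (h : IsBell r k) (x : ℝ) (hx : |x| < r + 1 / 2) :
    0 < windowIntegral k x := by
  have h0 : 0 ≤ |x| := abs_nonneg x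
  have hz := h.windowIntegral_eq_zero (-(r + 1 / 2)) (by rw [abs_neg]; exact le_abs_self _)
  rw [← h.windowIntegral_neg_abs, ← hz]
  exact h.strictMonoOn_windowIntegral ⟨le_rfl, by linarith⟩ ⟨by linarith, by linarith⟩
    (by linarith)

lemma integral_centralDiff_reflect_le (h : IsBell r k) {a b σ : ℝ} (hab : a ≤ b) (hb : b ≤ 0)
    (hσ : σ ≤ -(r + 1 / 2)) (hσa : σ ≤ 2 * a) :
    ∫ s in (σ - b)..(σ - a), centralDiff k s ≤ ∫ s in a..b, centralDiff k s := by
  have hi := (h.intervalIntegrable_centralDiff (σ - a) (σ - b)).comp_sub_left σ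
  simp only [sub_sub_cancel] at hi
  rw [← intervalIntegral.integral_comp_sub_left (fun s => centralDiff k s) σ]
  refine intervalIntegral.integral_mono_on_of_le_Ioo hab hi
    (h.intervalIntegrable_centralDiff _ _) fun s hs => ?_
  exact h.centralDiff_le s (σ - s) (by linarith [hs.1]) (hs.2.trans_le hb) (by linarith)

lemma centralDiff_windowIntegral (h : IsBell r k) (x : ℝ) :
    centralDiff (windowIntegral k) x = ∫ s in (x - 1 / 2)..(x + 1 / 2), centralDiff k s :=
  h.windowIntegral_sub _ _

lemma centralDiff_windowIntegral_le (h : IsBell r k) (hr : 1 / 2 ≤ r) (x y : ℝ) (hyx : y ≤ x)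
    (hx : x < 0) (hxy : x + y ≤ -(r + 1 / 2 + 1 / 2)) :
    centralDiff (windowIntegral k) y ≤ centralDiff (windowIntegral k) x := by
  have i := h.intervalIntegrable_centralDiff
  have add (a b c : ℝ) := intervalIntegral.integral_add_adjacent_intervals (i a b) (i b c)
  have nonneg {a b : ℝ} (hab : a ≤ b) (hb : b ≤ 0) : 0 ≤ ∫ s in a..b, centralDiff k s :=
    intervalIntegral.integral_nonneg hab fun s hs => h.centralDiff_nonneg (hs.2.trans hb)
  rw [h.centralDiff_windowIntegral, h.centralDiff_windowIntegral]
  rcases le_or_gt (x + 1 / 2) 0 with hx2 | hx2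
  · rcases le_total (x - y) 1 with hd | hd
    · have key := h.integral_centralDiff_reflect_le (a := y + 1 / 2) (b := x + 1 / 2)
        (σ := x + y) (by linarith) hx2 (by linarith) (by linarith)
      rw [show x + y - (x + 1 / 2) = y - 1 / 2 by ring,
        show x + y - (y + 1 / 2) = x - 1 / 2 by ring] at key
      linarith [add (y - 1 / 2) (x - 1 / 2) (y + 1 / 2), add (x - 1 / 2) (y + 1 / 2) (x + 1 / 2)]
    · have key := h.integral_centralDiff_reflect_le (a := x - 1 / 2) (b := x + 1 / 2)
        (σ := x + y) (by linarith) hx2 (by linarith) (by linarith)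
      rwa [show x + y - (x + 1 / 2) = y - 1 / 2 by ring,
        show x + y - (x - 1 / 2) = y + 1 / 2 by ring] at key
  · have key := h.integral_centralDiff_reflect_le (a := -(1 / 2)) (b := -x - 1 / 2)
      (σ := -(r + 1) - x) (by linarith) (by linarith) (by linarith) (by linarith)
    rw [show -(r + 1) - x - (-x - 1 / 2) = -(r + 1 / 2) by ring] at key
    have odd : ∫ s in (-x - 1 / 2)..(x + 1 / 2), centralDiff k s = 0 := by
      have e := intervalIntegral.integral_comp_neg (a := -x - 1 / 2) (b := x + 1 / 2)
        (centralDiff k)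
      simp only [h.centralDiff_neg, intervalIntegral.integral_neg] at e
      rw [show -(x + 1 / 2) = -x - 1 / 2 by ring,
        show -(-x - 1 / 2) = x + 1 / 2 by ring] at e
      linarith
    have left : ∫ s in (y - 1 / 2)..(-(r + 1 / 2)), centralDiff k s = 0 := by
      rw [intervalIntegral.integral_of_le (by linarith),
        MeasureTheory.integral_Ioc_eq_integral_Ioo]
      exact MeasureTheory.setIntegral_eq_zero_of_forall_eq_zero fun t ht =>
        h.centralDiff_eq_zero ht.2
    linarith [add (y - 1 / 2) (-(r + 1 / 2)) (y + 1 / 2),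
      add (-(r + 1 / 2)) (y + 1 / 2) (-(r + 1) - x - -(1 / 2)),
      nonneg (a := y + 1 / 2) (b := -(r + 1) - x - -(1 / 2)) (by linarith) (by linarith),
      add (x - 1 / 2) (-x - 1 / 2) (x + 1 / 2), add (x - 1 / 2) (-(1 / 2)) (-x - 1 / 2),
      nonneg (a := x - 1 / 2) (b := -(1 / 2)) (by linarith) (by linarith)]

lemma centralDiff_windowIntegral_pos (h : IsBell r k) (hr : 0 ≤ r) (s : ℝ)
    (hs : -(r + 1 / 2 + 1 / 2) < s) (hs0 : s < 0) : 0 < centralDiff (windowIntegral k) s := by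
  have habs : |s + 1 / 2| < -(s - 1 / 2) := by
    rw [abs_lt]
    constructor <;> linarith
  refine sub_pos.2 ?_
  rcases le_or_gt (-(r + 1 / 2)) (s - 1 / 2) with hc | hc
  · rw [← h.windowIntegral_neg_abs (s + 1 / 2)]
    have h0 := abs_nonneg (s + 1 / 2)
    exact h.strictMonoOn_windowIntegral ⟨hc, by linarith⟩ ⟨by linarith, by linarith⟩
      (by linarith)
  · rw [h.windowIntegral_eq_zero (s - 1 / 2) (le_abs.2 (Or.inr (by linarith)))]
    rcases lt_or_ge |s + 1 / 2| (r + 1 / 2) with hlt | hge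
    · exact h.windowIntegral_pos _ hlt
    · exfalso
      rcases le_abs.1 hge with h1 | h1 <;> linarith

lemma windowIntegral (h : IsBell r k) (hr : 1 / 2 ≤ r) :
    IsBell (r + 1 / 2) (windowIntegral k) where
  intervalIntegrable a b := h.continuous_windowIntegral.intervalIntegrable a b
  even := h.windowIntegral_neg
  le_of_abs_le := h.windowIntegral_le_of_abs_le
  eq_zero x hx := h.windowIntegral_eq_zero x hx.le
  pos := h.windowIntegral_pos
  centralDiff_pos := h.centralDiff_windowIntegral_pos (by linarith)
  centralDiff_le := h.centralDiff_windowIntegral_le hr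

lemma tsupport_eq (h : IsBell r k) (hr : 0 < r) : tsupport k = Icc (-r) r := by
  apply Subset.antisymm
  · refine closure_minimal (fun x hx => ?_) isClosed_Icc
    rw [mem_Icc, ← abs_le]
    by_contra hlt
    exact hx (h.eq_zero x (not_le.1 hlt))
  · rw [← closure_Ioo (by linarith : -r ≠ r)]
    exact closure_mono fun x hx => (h.pos x (abs_lt.2 hx)).ne'

/-- Second differences of a window integral are nonnegative as long as the centre lies in the
left quarter of the support and the right node does not pass the origin. -/
lemma two_mul_windowIntegral_le (h : IsBell r k) {a y : ℝ} (ha : 0 ≤ a)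
    (hy : y ≤ -((r + 1 / 2) / 2)) (hya : y + a ≤ 0) :
    2 * _root_.windowIntegral k y ≤
      _root_.windowIntegral k (y + a) + _root_.windowIntegral k (y - a) := by
  have key := h.integral_centralDiff_reflect_le (a := y) (b := y + a) (σ := 2 * y)
    (by linarith) hya (by linarith) le_rfl
  rw [show 2 * y - (y + a) = y - a by ring, show 2 * y - y = y by ring,
    ← h.windowIntegral_sub, ← h.windowIntegral_sub] at key
  linarith

lemma Delta2_windowIntegral_nonneg (h : IsBell r k) {a x : ℝ} (ha : 0 ≤ a)
    (hx : x ≤ -((r + 1 / 2) / 2) + 3 * a / 4) :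
    0 ≤ Delta2 a (_root_.windowIntegral k) x := by
  have hx2 : x - 2 * a = x - a - a := by ring
  rw [Delta2, hx2]
  rcases le_or_gt x 0 with h0 | h0
  · have := h.two_mul_windowIntegral_le (a := a) (y := x - a) ha (by linarith) (by linarith)
    rw [sub_add_cancel] at this
    linarith
  · have nonneg (z : ℝ) : 0 ≤ _root_.windowIntegral k z := by
      rcases lt_or_ge |z| (r + 1 / 2) with hz | hz
      · exact (h.windowIntegral_pos z hz).le
      · exact (h.windowIntegral_eq_zero z hz).ge
    rcases le_or_gt (x - a) (-(r + 1 / 2)) with hc | hc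
    · rw [h.windowIntegral_eq_zero (x - a) (le_abs.2 (Or.inr (by linarith)))]
      linarith [nonneg x, nonneg (x - a - a)]
    · have key := h.two_mul_windowIntegral_le (a := x - a + (r + 1 / 2)) (y := x - a)
        (by linarith) (by linarith) (by linarith)
      rw [h.windowIntegral_eq_zero (x - a - (x - a + (r + 1 / 2)))
        (le_abs.2 (Or.inr (by linarith)))] at key
      have hle := h.windowIntegral_le_of_abs_le x (x - a + (x - a + (r + 1 / 2))) (by
        rw [abs_of_pos h0]
        exact le_abs.2 (Or.inr (by linarith)))
      linarith [nonneg (x - a - a)]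

end IsBell

lemma Bspline_one_eq_indicator :
    Bspline 1 = (Icc (-(1 / 2) : ℝ) (1 / 2)).indicator (fun _ => (1 : ℝ)) := by
  funext x
  simp only [Bspline, indicator]

lemma isBell_Bspline_one : IsBell (1 / 2) (Bspline 1) where
  intervalIntegrable a b := by
    rw [Bspline_one_eq_indicator]
    refine MeasureTheory.IntegrableOn.intervalIntegrable ?_
    exact MeasureTheory.Integrable.integrableOn
      ((MeasureTheory.integrable_indicator_iff measurableSet_Icc).2
        (MeasureTheory.integrableOn_const (by simp)))
  even x := by
    simp only [Bspline, mem_Icc, ← abs_le, abs_neg]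
  le_of_abs_le x y hxy := by
    simp only [Bspline, mem_Icc, ← abs_le]
    split_ifs <;> linarith
  eq_zero x hx := by
    simp only [Bspline, mem_Icc, ← abs_le]
    rw [if_neg (not_le.2 hx)]
  pos x hx := by
    simp only [Bspline, mem_Icc, ← abs_le]
    rw [if_pos hx.le]
    exact one_pos
  centralDiff_pos s hs hs0 := by
    simp only [centralDiff, Bspline, mem_Icc]
    rw [if_pos ⟨by linarith, by linarith⟩, if_neg (fun hh => by linarith [hh.1])]
    norm_num
  centralDiff_le x y hyx hx hxy := by
    simp only [centralDiff, Bspline, mem_Icc]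
    rw [if_neg (c := _ ∧ x - 1 / 2 ≤ _) (fun hh => by linarith [hh.1]),
      if_neg (c := _ ∧ y - 1 / 2 ≤ _) (fun hh => by linarith [hh.1])]
    split_ifs with h1 h2
    · exact le_rfl
    · exact absurd ⟨by linarith [h1.1], by linarith⟩ h2
    · norm_num
    · exact le_rfl

lemma Bspline_succ_succ (n : ℕ) : Bspline (n + 2) = windowIntegral (Bspline (n + 1)) := by
  funext x
  have e : ∀ t, Bspline (n + 1) (x - t) * Bspline 1 t =
      (Icc (-(1 / 2) : ℝ) (1 / 2)).indicator (fun t => Bspline (n + 1) (x - t)) t := by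
    intro t
    rw [Bspline_one_eq_indicator]
    by_cases ht : t ∈ Icc (-(1 / 2) : ℝ) (1 / 2) <;> simp only [ht, indicator] <;> simp
  rw [Bspline]
  simp only [e]
  rw [MeasureTheory.integral_indicator measurableSet_Icc,
    MeasureTheory.integral_Icc_eq_integral_Ioc,
    ← intervalIntegral.integral_of_le (by norm_num),
    intervalIntegral.integral_comp_sub_left (fun t => Bspline (n + 1) t), sub_neg_eq_add]
  rfl

lemma isBell_Bspline (n : ℕ) : IsBell (((n + 1 : ℕ) : ℝ) / 2) (Bspline (n + 1)) := by
  induction n with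
  | zero => simpa using isBell_Bspline_one
  | succ n ih =>
    rw [Bspline_succ_succ]
    have hn : (0 : ℝ) ≤ n := n.cast_nonneg
    convert ih.windowIntegral (by push_cast; linarith) using 1
    push_cast
    ring

theorem stmt13 (N : ℕ) (hN : 2 ≤ N) :
    Continuous (Bspline N) ∧
    tsupport (Bspline N) = Set.Icc (-((N : ℝ) / 2)) ((N : ℝ) / 2) ∧
    (∀ x : ℝ, Bspline N (-x) = Bspline N x) ∧
    StrictMonoOn (Bspline N) (Set.Icc (-((N : ℝ) / 2)) 0) ∧
    ∀ a ∈ Set.Ioo (0 : ℝ) (N : ℝ),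
      (∀ x ∈ Set.Icc (-((N : ℝ) / 2)) (-((N : ℝ) / 4) + 3 * a / 4),
        0 ≤ Delta2 a (Bspline N) x) ∧
      memV (N : ℝ) a (Bspline N) := by
  obtain ⟨n, rfl⟩ : ∃ n, N = n + 2 := ⟨N - 2, by omega⟩
  have hk := isBell_Bspline n
  have hf := isBell_Bspline (n + 1)
  have hr : ((n + 1 : ℕ) : ℝ) / 2 + 1 / 2 = ((n + 2 : ℕ) : ℝ) / 2 := by
    push_cast
    ring
  have hcont : Continuous (Bspline (n + 2)) := by
    rw [Bspline_succ_succ]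
    exact hk.continuous_windowIntegral
  have hsupp := hf.tsupport_eq (by positivity)
  have hmono : StrictMonoOn (Bspline (n + 2)) (Icc (-(((n + 2 : ℕ) : ℝ) / 2)) 0) := by
    rw [Bspline_succ_succ, ← hr]
    exact hk.strictMonoOn_windowIntegral
  refine ⟨hcont, hsupp, hf.even, hmono, fun a ha => ?_⟩
  have hdelta (x : ℝ) (hx : x ≤ -(((n + 2 : ℕ) : ℝ) / 4) + 3 * a / 4) :
      0 ≤ Delta2 a (Bspline (n + 2)) x := by
    rw [Bspline_succ_succ]
    exact hk.Delta2_windowIntegral_nonneg ha.1.le (by rw [hr]; linarith)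
  exact ⟨fun x hx => hdelta x hx.2, hcont, hsupp, hf.even, hmono,
    fun _ x hx => hdelta x hx.2,
    fun h3 => ⟨fun x hx => hdelta x (by linarith [hx.2]), hdelta _ le_rfl⟩⟩
end
end

section
/- Let N be an integer with N ≥ 2 and define f_N(x) = cos^{2N-2}(πx/N) for x ∈ [-N/2, N/2] and f_N(x) = 0 otherwise. Then f_N is continuous with support exactly [-N/2, N/2], f_N(-x) = f_N(x) for all x ∈ ℝ, f_N is strictly increasing on [-N/2, 0], and for every a ∈ (0, N) and every x ∈ [-N/2, -N/4 + 3a/4] one has Δ²_a f_N(x) ≥ 0; consequently f_N ∈ V_{N,a} for every a ∈ (0, N). -/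
open Set

noncomputable section

/-- `f_N(x) = cos^(2N-2)(πx/N)` on `[-N/2, N/2]`, extended by zero. -/
def fN (N : ℕ) (x : ℝ) : ℝ :=
  if x ∈ Set.Icc (-((N : ℝ) / 2)) ((N : ℝ) / 2) then
    Real.cos (Real.pi * x / N) ^ (2 * N - 2) else 0

/-- If `u + w ≥ 2 v` with all terms nonnegative, the same holds for positive powers. -/
theorem two_mul_pow_le_pow_add_pow {u v w : ℝ} (hu : 0 ≤ u) (hv : 0 ≤ v) (hw : 0 ≤ w)
    (h : 2 * v ≤ u + w) (k : ℕ) : 2 * v ^ (k + 1) ≤ u ^ (k + 1) + w ^ (k + 1) := by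
  have h1 : (2 * v) ^ (k + 1) ≤ (u + w) ^ (k + 1) := pow_le_pow_left₀ (by positivity) h _
  have h2 := add_pow_le hu hw (k + 1)
  rw [Nat.add_sub_cancel] at h2
  rw [mul_pow] at h1
  refine le_of_mul_le_mul_left ?_ (pow_pos (two_pos : (0 : ℝ) < 2) k)
  calc (2 : ℝ) ^ k * (2 * v ^ (k + 1)) = 2 ^ (k + 1) * v ^ (k + 1) := by ring
    _ ≤ _ := h1.trans h2

/-- The second difference of `cos ^ 2` is nonnegative where `cos (2 (t - s)) ≤ 0`. -/
theorem two_mul_cos_sq_le_of_cos_nonpos {t s : ℝ} (h : Real.cos (2 * (t - s)) ≤ 0) :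
    2 * Real.cos (t - s) ^ 2 ≤ Real.cos t ^ 2 + Real.cos (t - 2 * s) ^ 2 := by
  have h1 : Real.cos (2 * t) + Real.cos (2 * (t - 2 * s))
      = 2 * Real.cos (2 * (t - s)) * Real.cos (2 * s) := by
    rw [Real.cos_add_cos]
    ring_nf
  have h2 := Real.cos_le_one (2 * s)
  rw [Real.cos_sq, Real.cos_sq, Real.cos_sq]
  nlinarith

theorem two_mul_cos_sq_le_cos_sq {t s : ℝ} (h1 : -(Real.pi / 2) ≤ t - s)
    (h2 : t - 2 * s ≤ -(Real.pi / 2)) (h3 : t ≤ -(Real.pi / 4) + 3 * s / 4) :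
    2 * Real.cos (t - s) ^ 2 ≤ Real.cos t ^ 2 := by
  obtain ⟨b, hb⟩ : ∃ b, b = t - s + Real.pi / 2 := ⟨_, rfl⟩
  have hpi := Real.pi_pos
  have e1 : Real.cos (t - s) = Real.sin b := by
    rw [← Real.cos_sub_pi_div_two]; congr 1; linarith
  have e2 : Real.cos t = Real.sin (b + s) := by
    rw [← Real.cos_sub_pi_div_two]; congr 1; linarith
  have hb0 : 0 ≤ b := by linarith
  have hs0 : 0 ≤ Real.sin b := Real.sin_nonneg_of_nonneg_of_le_pi hb0 (by linarith)
  have hc2 : 0 ≤ Real.cos (2 * b) :=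
    Real.cos_nonneg_of_neg_pi_div_two_le_of_le (by linarith) (by linarith)
  have hc0 : 0 ≤ Real.cos b :=
    Real.cos_nonneg_of_neg_pi_div_two_le_of_le (by linarith) (by linarith)
  have hs : Real.sin (2 * b) ≤ Real.sin (b + s) := by
    rw [← sub_nonneg, Real.sin_sub_sin]
    have := Real.sin_nonneg_of_nonneg_of_le_pi (x := (b + s - 2 * b) / 2)
      (by linarith) (by linarith)
    have := Real.cos_nonneg_of_neg_pi_div_two_le_of_le (x := (b + s + 2 * b) / 2)
      (by linarith) (by linarith)
    positivity
  rw [Real.sin_two_mul] at hs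
  rw [Real.cos_two_mul] at hc2
  have hsq := pow_le_pow_left₀ (by positivity) hs 2
  rw [e1, e2]
  nlinarith [mul_nonneg hc2 (sq_nonneg (Real.sin b))]

theorem fN_eq_cos_clamp {N : ℕ} (hN : 2 ≤ N) (x : ℝ) :
    fN N x = Real.cos (Real.pi * max (-((N : ℝ) / 2)) (min ((N : ℝ) / 2) x) / N)
      ^ (2 * N - 2) := by
  have hN0 : (0 : ℝ) < N := by positivity
  have hne : 2 * N - 2 ≠ 0 := by omega
  unfold fN
  split_ifs with h
  · rw [min_eq_right h.2, max_eq_right h.1]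
  · symm
    rw [pow_eq_zero_iff hne]
    rcases lt_or_ge x (-((N : ℝ) / 2)) with hx | hx
    · rw [min_eq_right (by linarith), max_eq_left hx.le,
        show Real.pi * -((N : ℝ) / 2) / N = -(Real.pi / 2) by field_simp, Real.cos_neg,
        Real.cos_pi_div_two]
    · have hx' : (N : ℝ) / 2 < x := by
        by_contra! h'
        exact h ⟨hx, h'⟩
      rw [min_eq_left hx'.le, max_eq_right (by linarith),
        show Real.pi * ((N : ℝ) / 2) / N = Real.pi / 2 by field_simp, Real.cos_pi_div_two]

theorem continuous_fN {N : ℕ} (hN : 2 ≤ N) : Continuous (fN N) := by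
  rw [funext (fN_eq_cos_clamp hN)]
  fun_prop

theorem fN_eq_zero {N : ℕ} (hN : 2 ≤ N) {x : ℝ} (hx : x ≤ -((N : ℝ) / 2)) : fN N x = 0 := by
  have hN0 : (0 : ℝ) < N := by positivity
  have hne : 2 * N - 2 ≠ 0 := by omega
  rw [fN_eq_cos_clamp hN, min_eq_right (by linarith), max_eq_left hx,
    show Real.pi * -((N : ℝ) / 2) / N = -(Real.pi / 2) by field_simp, Real.cos_neg,
    Real.cos_pi_div_two, zero_pow hne]

theorem fN_neg (N : ℕ) (x : ℝ) : fN N (-x) = fN N x := by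
  have h : -x ∈ Set.Icc (-((N : ℝ) / 2)) ((N : ℝ) / 2) ↔
      x ∈ Set.Icc (-((N : ℝ) / 2)) ((N : ℝ) / 2) := by
    simp only [mem_Icc]
    constructor <;> rintro ⟨h1, h2⟩ <;> constructor <;> linarith
  simp only [fN, h]
  rw [show Real.pi * -x / N = -(Real.pi * x / N) by ring, Real.cos_neg]

theorem fN_of_mem {N : ℕ} {x : ℝ} (hx : x ∈ Set.Icc (-((N : ℝ) / 2)) ((N : ℝ) / 2)) :
    fN N x = Real.cos (Real.pi * x / N) ^ (2 * N - 2) := if_pos hx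

theorem support_fN {N : ℕ} (hN : 2 ≤ N) :
    Function.support (fN N) = Set.Ioo (-((N : ℝ) / 2)) ((N : ℝ) / 2) := by
  have hN0 : (0 : ℝ) < N := by positivity
  ext x
  rw [Function.mem_support]
  constructor
  · intro h
    constructor
    · by_contra! hx
      exact h (fN_eq_zero hN hx)
    · by_contra! hx
      exact h (by rw [← fN_neg, fN_eq_zero hN (by linarith)])
  · intro h
    rw [fN_of_mem ⟨h.1.le, h.2.le⟩]
    refine pow_ne_zero _ (Real.cos_pos_of_mem_Ioo ⟨?_, ?_⟩).ne'
    · rw [lt_div_iff₀ hN0]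
      nlinarith [Real.pi_pos, h.1]
    · rw [div_lt_iff₀ hN0]
      nlinarith [Real.pi_pos, h.2]

theorem tsupport_fN {N : ℕ} (hN : 2 ≤ N) :
    tsupport (fN N) = Set.Icc (-((N : ℝ) / 2)) ((N : ℝ) / 2) := by
  have hN0 : (0 : ℝ) < N := by positivity
  rw [tsupport, support_fN hN, closure_Ioo (by linarith)]

theorem strictMonoOn_fN {N : ℕ} (hN : 2 ≤ N) :
    StrictMonoOn (fN N) (Set.Icc (-((N : ℝ) / 2)) 0) := by
  have hN0 : (0 : ℝ) < N := by positivity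
  have hpi := Real.pi_pos
  intro x hx y hy hxy
  rw [fN_of_mem ⟨hx.1, by linarith [hx.2]⟩, fN_of_mem ⟨hy.1, by linarith [hy.2]⟩]
  have hx1 : -(Real.pi / 2) ≤ Real.pi * x / N := by
    rw [le_div_iff₀ hN0]
    nlinarith [hx.1]
  have hlt : Real.pi * x / N < Real.pi * y / N := by gcongr
  have hy0 : Real.pi * y / N ≤ 0 :=
    div_nonpos_of_nonpos_of_nonneg (mul_nonpos_of_nonneg_of_nonpos hpi.le hy.2) hN0.le
  refine pow_lt_pow_left₀ ?_ (Real.cos_nonneg_of_neg_pi_div_two_le_of_le hx1 (by linarith))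
    (by omega)
  rw [← Real.cos_neg (Real.pi * x / N), ← Real.cos_neg (Real.pi * y / N)]
  exact Real.cos_lt_cos_of_nonneg_of_le_pi (by linarith) (by linarith) (by linarith)

theorem Delta2_fN_nonneg {N : ℕ} (hN : 2 ≤ N) {a : ℝ} (ha : a ∈ Set.Ioo (0 : ℝ) N) {x : ℝ}
    (hx : x ∈ Set.Icc (-((N : ℝ) / 2)) (-((N : ℝ) / 4) + 3 * a / 4)) :
    0 ≤ Delta2 a (fN N) x := by
  have hN0 : (0 : ℝ) < N := by positivity
  have hpi := Real.pi_pos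
  obtain ⟨ha0, haN⟩ := ha
  obtain ⟨hx1, hx2⟩ := hx
  obtain ⟨k, rfl⟩ : ∃ k, N = k + 2 := ⟨N - 2, by omega⟩
  have hexp : 2 * (k + 2) - 2 = 2 * (k + 1) := by omega
  generalize hM : ((k + 2 : ℕ) : ℝ) = M at *
  have hc : 0 < Real.pi / M := by positivity
  have hcM : Real.pi / M * M = Real.pi := by field_simp
  have val : ∀ y, -(M / 2) ≤ y → y ≤ M / 2 →
      fN (k + 2) y = (Real.cos (Real.pi / M * y) ^ 2) ^ (k + 1) := by
    intro y h1 h2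
    rw [fN_of_mem (by rw [hM]; exact ⟨h1, h2⟩), hexp, pow_mul, hM, mul_div_right_comm]
  have nonneg : ∀ y, 0 ≤ fN (k + 2) y := by
    intro y
    unfold fN
    split_ifs
    · rw [hexp, pow_mul]; positivity
    · exact le_rfl
  unfold Delta2
  rcases le_or_gt (x - a) (-(M / 2)) with h1 | h1
  · rw [fN_eq_zero hN (x := x - a) (by rwa [hM])]
    linarith [nonneg x, nonneg (x - 2 * a)]
  have ht : Real.pi / M * x ≤ -(Real.pi / 4) + 3 * (Real.pi / M * a) / 4 := by
    nlinarith [mul_le_mul_of_nonneg_left hx2 hc.le]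
  have ht1 : -(Real.pi / 2) ≤ Real.pi / M * x - Real.pi / M * a := by
    nlinarith [mul_le_mul_of_nonneg_left h1.le hc.le]
  have hs : 0 < Real.pi / M * a := by positivity
  rw [val x hx1 (by linarith), val (x - a) h1.le (by linarith), mul_sub (Real.pi / M) x a]
  rcases le_or_gt (x - 2 * a) (-(M / 2)) with h2 | h2
  · have ht2 : Real.pi / M * x - 2 * (Real.pi / M * a) ≤ -(Real.pi / 2) := by
      nlinarith [mul_le_mul_of_nonneg_left h2 hc.le]
    rw [fN_eq_zero hN (x := x - 2 * a) (by rwa [hM])]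
    have := two_mul_pow_le_pow_add_pow (sq_nonneg _) (sq_nonneg _) le_rfl
      ((two_mul_cos_sq_le_cos_sq ht1 ht2 ht).trans (add_zero _).ge) k
    rw [zero_pow k.succ_ne_zero] at this
    linarith
  · have ht2 : -(Real.pi / 2) ≤ Real.pi / M * x - 2 * (Real.pi / M * a) := by
      nlinarith [mul_le_mul_of_nonneg_left h2.le hc.le]
    rw [val (x - 2 * a) h2.le (by linarith),
      show Real.pi / M * (x - 2 * a) = Real.pi / M * x - 2 * (Real.pi / M * a) by ring]
    have hcos : Real.cos (2 * (Real.pi / M * x - Real.pi / M * a)) ≤ 0 := by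
      rw [← Real.cos_neg]
      exact Real.cos_nonpos_of_pi_div_two_le_of_le (by linarith) (by linarith)
    have := two_mul_pow_le_pow_add_pow (sq_nonneg _) (sq_nonneg _) (sq_nonneg _)
      (two_mul_cos_sq_le_of_cos_nonpos hcos) k
    linarith

theorem stmt14 (N : ℕ) (hN : 2 ≤ N) :
    Continuous (fN N) ∧
    tsupport (fN N) = Set.Icc (-((N : ℝ) / 2)) ((N : ℝ) / 2) ∧
    (∀ x : ℝ, fN N (-x) = fN N x) ∧
    StrictMonoOn (fN N) (Set.Icc (-((N : ℝ) / 2)) 0) ∧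
    ∀ a ∈ Set.Ioo (0 : ℝ) (N : ℝ),
      (∀ x ∈ Set.Icc (-((N : ℝ) / 2)) (-((N : ℝ) / 4) + 3 * a / 4),
        0 ≤ Delta2 a (fN N) x) ∧
      memV (N : ℝ) a (fN N) := by
  have hN0 : (0 : ℝ) < N := by positivity
  refine ⟨continuous_fN hN, tsupport_fN hN, fN_neg N, strictMonoOn_fN hN, fun a ha => ?_⟩
  have hD : ∀ x ∈ Set.Icc (-((N : ℝ) / 2)) (-((N : ℝ) / 4) + 3 * a / 4),
      0 ≤ Delta2 a (fN N) x := fun x hx => Delta2_fN_nonneg hN ha hx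
  refine ⟨hD, continuous_fN hN, tsupport_fN hN, fN_neg N, strictMonoOn_fN hN,
    fun _ => hD, fun h => ⟨fun x hx => hD x ⟨hx.1, by linarith [hx.2]⟩, hD _ ⟨?_, le_rfl⟩⟩⟩
  linarith
end
end

section
/- Let N > 0 and define h_N(x) = e^{-|x|} - e^{-N/2} for x ∈ [-N/2, N/2] and h_N(x) = 0 otherwise. Then h_N is continuous with support exactly [-N/2, N/2], h_N(-x) = h_N(x) for all x ∈ ℝ, h_N is strictly increasing on [-N/2, 0], and for every a ∈ (0, N) and every x ∈ [-N/2, -N/4 + 3a/4] one has Δ²_a h_N(x) ≥ 0; consequently h_N ∈ V_{N,a} for every a ∈ (0, N). -/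
open Set

noncomputable section

/-- `h_N(x) = e^{-|x|} - e^{-N/2}` on `[-N/2, N/2]`, extended by zero. -/
def hN (N : ℝ) (x : ℝ) : ℝ :=
  if x ∈ Set.Icc (-(N / 2)) (N / 2) then Real.exp (-|x|) - Real.exp (-(N / 2)) else 0

theorem hN_eq_max (N x : ℝ) :
    hN N x = max (Real.exp (-|x|) - Real.exp (-(N / 2))) 0 := by
  unfold hN
  split_ifs with h
  · have hx : |x| ≤ N / 2 := abs_le.2 h
    rw [max_eq_left (sub_nonneg.2 (Real.exp_le_exp.2 (by linarith)))]
  · have hx : N / 2 < |x| := by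
      by_contra! h'
      exact h (abs_le.1 h')
    rw [max_eq_right (sub_nonpos.2 (Real.exp_le_exp.2 (by linarith)))]

theorem continuous_hN (N : ℝ) : Continuous (hN N) := by
  rw [funext (hN_eq_max N)]
  fun_prop

theorem hN_nonneg (N x : ℝ) : 0 ≤ hN N x := by
  rw [hN_eq_max]
  exact le_max_right _ _

theorem le_hN (N x : ℝ) : Real.exp (-|x|) - Real.exp (-(N / 2)) ≤ hN N x := by
  rw [hN_eq_max]
  exact le_max_left _ _

theorem hN_neg (N x : ℝ) : hN N (-x) = hN N x := by
  simp [hN_eq_max]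

theorem hN_of_mem_Icc {N x : ℝ} (hx : x ∈ Set.Icc (-(N / 2)) 0) :
    hN N x = Real.exp x - Real.exp (-(N / 2)) := by
  rw [hN_eq_max, abs_of_nonpos hx.2, neg_neg,
    max_eq_left (sub_nonneg.2 (Real.exp_le_exp.2 hx.1))]

theorem hN_of_le {N x : ℝ} (hN0 : 0 ≤ N) (hx : x ≤ -(N / 2)) : hN N x = 0 := by
  rw [hN_eq_max, abs_of_nonpos (by linarith), neg_neg,
    max_eq_right (sub_nonpos.2 (Real.exp_le_exp.2 hx))]

theorem support_hN (N : ℝ) : Function.support (hN N) = Set.Ioo (-(N / 2)) (N / 2) := by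
  ext x
  rw [Function.mem_support, ← (hN_nonneg N x).lt_iff_ne', hN_eq_max, lt_max_iff,
    or_iff_left (lt_irrefl _), sub_pos, Real.exp_lt_exp, neg_lt_neg_iff, abs_lt, Set.mem_Ioo]

theorem tsupport_hN {N : ℝ} (hN0 : 0 < N) :
    tsupport (hN N) = Set.Icc (-(N / 2)) (N / 2) := by
  rw [tsupport, support_hN, closure_Ioo (by linarith)]

theorem strictMonoOn_hN (N : ℝ) : StrictMonoOn (hN N) (Set.Icc (-(N / 2)) 0) := by
  intro x hx y hy hxy
  rw [hN_of_mem_Icc hx, hN_of_mem_Icc hy]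
  exact sub_lt_sub_right (Real.exp_lt_exp.2 hxy) _

theorem two_mul_exp_le_exp_add_exp {m p q : ℝ} (h : 2 * m ≤ p + q) :
    2 * Real.exp m ≤ Real.exp p + Real.exp q := by
  have h₁ : Real.exp m ≤ Real.exp (p / 2) * Real.exp (q / 2) := by
    rw [← Real.exp_add]
    exact Real.exp_le_exp.2 (by linarith)
  have hp : Real.exp p = Real.exp (p / 2) ^ 2 := by
    rw [← Real.exp_nat_mul]
    congr 1
    push_cast
    ring
  have hq : Real.exp q = Real.exp (q / 2) ^ 2 := by
    rw [← Real.exp_nat_mul]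
    congr 1
    push_cast
    ring
  nlinarith [sq_nonneg (Real.exp (p / 2) - Real.exp (q / 2))]

theorem Delta2_hN_nonneg {N a x : ℝ} (hN0 : 0 < N) (ha : a ∈ Set.Ioo 0 N)
    (hx : x ≤ -(N / 4) + 3 * a / 4) : 0 ≤ Delta2 a (hN N) x := by
  obtain ⟨ha0, haN⟩ := ha
  unfold Delta2
  rcases le_total (x - a) (-(N / 2)) with hy | hy
  · rw [hN_of_le hN0.le hy]
    linarith [hN_nonneg N x, hN_nonneg N (x - 2 * a)]
  rw [hN_of_mem_Icc (x := x - a) ⟨hy, by linarith⟩]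
  have h₁ := le_hN N x
  rcases le_total (-(N / 2)) (x - 2 * a) with hz | hz
  · have hx0 : x ≤ 0 := by linarith
    rw [abs_of_nonpos hx0, neg_neg] at h₁
    rw [hN_of_mem_Icc (x := x - 2 * a) ⟨hz, by linarith⟩]
    have h₂ : 2 * Real.exp (x - a) ≤ Real.exp x + Real.exp (x - 2 * a) :=
      two_mul_exp_le_exp_add_exp (by linarith)
    linarith
  · rw [hN_of_le hN0.le hz]
    have h₂ : 2 * Real.exp (x - a) ≤ Real.exp (-|x|) + Real.exp (-(N / 2)) := by
      apply two_mul_exp_le_exp_add_exp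
      rcases abs_cases x with ⟨h, _⟩ | ⟨h, _⟩ <;> rw [h] <;> linarith
    linarith

theorem stmt15 (N : ℝ) (hNpos : 0 < N) :
    Continuous (hN N) ∧
    tsupport (hN N) = Set.Icc (-(N / 2)) (N / 2) ∧
    (∀ x : ℝ, hN N (-x) = hN N x) ∧
    StrictMonoOn (hN N) (Set.Icc (-(N / 2)) 0) ∧
    ∀ a ∈ Set.Ioo (0 : ℝ) N,
      (∀ x ∈ Set.Icc (-(N / 2)) (-(N / 4) + 3 * a / 4), 0 ≤ Delta2 a (hN N) x) ∧
      memV N a (hN N) := by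
  refine ⟨continuous_hN N, tsupport_hN hNpos, hN_neg N, strictMonoOn_hN N, fun a ha =>
    ⟨fun x hx => Delta2_hN_nonneg hNpos ha hx.2, continuous_hN N, tsupport_hN hNpos, hN_neg N,
      strictMonoOn_hN N, fun _ x hx => Delta2_hN_nonneg hNpos ha hx.2, fun h => ⟨fun x hx => ?_,
        Delta2_hN_nonneg hNpos ha le_rfl⟩⟩⟩
  exact Delta2_hN_nonneg hNpos ha (by linarith [hx.2])
end
end

section
/- Let N > 0 and define k_N(x) = 1/(1+|x|) - 1/(1+N/2) for x ∈ [-N/2, N/2] and k_N(x) = 0 otherwise. Then k_N is continuous with support exactly [-N/2, N/2], k_N(-x) = k_N(x) for all x ∈ ℝ, k_N is strictly increasing on [-N/2, 0], and for every a ∈ (0, N) and every x ∈ [-N/2, -N/4 + 3a/4] one has Δ²_a k_N(x) ≥ 0; consequently k_N ∈ V_{N,a} for every a ∈ (0, N). -/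
open Set

noncomputable section

/-- `k_N(x) = 1/(1+|x|) - 1/(1+N/2)` on `[-N/2, N/2]`, extended by zero. -/
def kN (N : ℝ) (x : ℝ) : ℝ :=
  if x ∈ Set.Icc (-(N / 2)) (N / 2) then 1 / (1 + |x|) - 1 / (1 + N / 2) else 0

theorem kN_eq_max {N : ℝ} (hN : 0 < N) (x : ℝ) :
    kN N x = max (1 / (1 + |x|) - 1 / (1 + N / 2)) 0 := by
  unfold kN
  split_ifs with h
  · rw [max_eq_left]
    exact sub_nonneg.2 (one_div_le_one_div_of_le (by positivity) (by linarith [abs_le.2 h]))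
  · rw [max_eq_right]
    have h' : N / 2 < |x| := by
      by_contra! hx
      exact h (abs_le.1 hx)
    exact sub_nonpos.2 (one_div_le_one_div_of_le (by positivity) (by linarith))

theorem kN_nonneg {N : ℝ} (hN : 0 < N) (x : ℝ) : 0 ≤ kN N x := by
  rw [kN_eq_max hN]
  exact le_max_right _ _

theorem le_kN {N : ℝ} (hN : 0 < N) (x : ℝ) :
    1 / (1 + |x|) - 1 / (1 + N / 2) ≤ kN N x := by
  rw [kN_eq_max hN]
  exact le_max_left _ _

theorem continuous_kN {N : ℝ} (hN : 0 < N) : Continuous (kN N) := by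
  have h : kN N = fun x => max (1 / (1 + |x|) - 1 / (1 + N / 2)) 0 := funext (kN_eq_max hN)
  rw [h]
  have h0 : ∀ x : ℝ, 1 + |x| ≠ 0 := fun x => by positivity
  fun_prop (disch := exact h0 _)

theorem support_kN {N : ℝ} (hN : 0 < N) :
    Function.support (kN N) = Set.Ioo (-(N / 2)) (N / 2) := by
  ext x
  have hx : kN N x ≠ 0 ↔ 0 < kN N x := (kN_nonneg hN x).lt_iff_ne'.symm
  rw [Function.mem_support, hx, kN_eq_max hN, lt_max_iff, or_iff_left (lt_irrefl _), sub_pos,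
    one_div_lt_one_div (by positivity) (by positivity), add_lt_add_iff_left, abs_lt, Set.mem_Ioo]

theorem tsupport_kN {N : ℝ} (hN : 0 < N) :
    tsupport (kN N) = Set.Icc (-(N / 2)) (N / 2) := by
  rw [tsupport, support_kN hN, closure_Ioo (by linarith)]

theorem kN_neg (N x : ℝ) : kN N (-x) = kN N x := by
  have h : -x ∈ Set.Icc (-(N / 2)) (N / 2) ↔ x ∈ Set.Icc (-(N / 2)) (N / 2) := by
    rw [Set.mem_Icc, Set.mem_Icc, ← abs_le, ← abs_le, abs_neg]
  simp only [kN, h, abs_neg]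

theorem strictMonoOn_kN {N : ℝ} (hN : 0 < N) :
    StrictMonoOn (kN N) (Set.Icc (-(N / 2)) 0) := by
  intro x hx y hy hxy
  have hmem : ∀ z ∈ Set.Icc (-(N / 2)) 0, z ∈ Set.Icc (-(N / 2)) (N / 2) :=
    fun z hz => ⟨hz.1, by linarith [hz.2]⟩
  rw [kN, kN, if_pos (hmem x hx), if_pos (hmem y hy), abs_of_nonpos hx.2, abs_of_nonpos hy.2]
  have h : 1 / (1 + -x) < 1 / (1 + -y) :=
    one_div_lt_one_div_of_lt (by linarith [hy.2]) (by linarith)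
  linarith

theorem Delta2_kN_nonneg {N a x : ℝ} (hN : 0 < N) (ha : a ∈ Set.Ioo 0 N)
    (hx : x ≤ -(N / 4) + 3 * a / 4) : 0 ≤ Delta2 a (kN N) x := by
  obtain ⟨ha0, haN⟩ := ha
  unfold Delta2
  have h1 := le_kN hN x
  have h2 := le_kN hN (x - 2 * a)
  have h3 := kN_nonneg hN x
  have h4 := kN_nonneg hN (x - 2 * a)
  have hxa : |x - a| = a - x := by rw [abs_of_nonpos (by linarith)]; ring
  rcases le_total (1 / (1 + |x - a|) - 1 / (1 + N / 2)) 0 with hm | hm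
  · rw [kN_eq_max hN (x - a), max_eq_right hm]
    linarith
  rw [kN_eq_max hN (x - a), max_eq_left hm, hxa]
  rcases le_total x 0 with hx0 | hx0
  · rw [abs_of_nonpos hx0] at h1
    rw [abs_of_nonpos (by linarith : x - 2 * a ≤ 0)] at h2
    have hp : 0 < 1 - x := by linarith
    have key : 2 * (1 / (1 + (a - x))) ≤ 1 / (1 + -x) + 1 / (1 + -(x - 2 * a)) := by
      rw [← sub_nonneg]
      have e : 1 / (1 + -x) + 1 / (1 + -(x - 2 * a)) - 2 * (1 / (1 + (a - x))) =
          2 * a ^ 2 / ((1 - x) * (1 - x + 2 * a) * (1 - x + a)) := by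
        have : 1 + -x ≠ 0 := by linarith
        have : 1 - x ≠ 0 := by linarith
        have : 1 + -(x - 2 * a) ≠ 0 := by linarith
        have : 1 - x + 2 * a ≠ 0 := by linarith
        have : 1 + (a - x) ≠ 0 := by linarith
        have : 1 - x + a ≠ 0 := by linarith
        field_simp
        ring
      rw [e]
      positivity
    linarith
  · rw [abs_of_nonneg hx0] at h1
    have hy : 1 / (1 + (a - x)) ≤ 1 / (1 + (x + N) / 3) :=
      one_div_le_one_div_of_le (by positivity) (by linarith)
    have key : 2 * (1 / (1 + (x + N) / 3)) ≤ 1 / (1 + x) + 1 / (1 + N / 2) := by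
      rw [← sub_nonneg]
      have e : 1 / (1 + x) + 1 / (1 + N / 2) - 2 * (1 / (1 + (x + N) / 3)) =
          (N / 2 - x) * (1 + N - x) /
            ((1 + x) * (1 + N / 2) * (3 + x + N)) := by
        field_simp
        ring
      rw [e]
      have : 0 ≤ N / 2 - x := by linarith
      have : 0 ≤ 1 + N - x := by linarith
      positivity
    linarith

theorem stmt16 (N : ℝ) (hNpos : 0 < N) :
    Continuous (kN N) ∧
    tsupport (kN N) = Set.Icc (-(N / 2)) (N / 2) ∧
    (∀ x : ℝ, kN N (-x) = kN N x) ∧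
    StrictMonoOn (kN N) (Set.Icc (-(N / 2)) 0) ∧
    ∀ a ∈ Set.Ioo (0 : ℝ) N,
      (∀ x ∈ Set.Icc (-(N / 2)) (-(N / 4) + 3 * a / 4), 0 ≤ Delta2 a (kN N) x) ∧
      memV N a (kN N) := by
  refine ⟨continuous_kN hNpos, tsupport_kN hNpos, kN_neg N, strictMonoOn_kN hNpos,
    fun a ha => ?_⟩
  have hD : ∀ x ≤ -(N / 4) + 3 * a / 4, 0 ≤ Delta2 a (kN N) x :=
    fun x hx => Delta2_kN_nonneg hNpos ha hx
  exact ⟨fun x hx => hD x hx.2, continuous_kN hNpos, tsupport_kN hNpos, kN_neg N,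
    strictMonoOn_kN hNpos, fun _ x hx => hD x hx.2,
    fun haN => ⟨fun x hx => hD x (by linarith [hx.2]), hD _ le_rfl⟩⟩
end
end

section
/- Let N > 0 and define p_N(x) = 1/(1+x²) - 1/(1+(N/2)²) for x ∈ [-N/2, N/2] and p_N(x) = 0 otherwise. Then for every a with 3N/7 ≤ a < N and every x ∈ [-N/2, -N/4 + 3a/4] one has Δ²_a p_N(x) ≥ 0; consequently p_N ∈ V_{N,a} for every a ∈ [3N/7, N). -/
open Set

noncomputable section

/-- `p_N(x) = 1/(1+x²) - 1/(1+(N/2)²)` on `[-N/2, N/2]`, extended by zero. -/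
def pN (N : ℝ) (x : ℝ) : ℝ :=
  if x ∈ Set.Icc (-(N / 2)) (N / 2) then 1 / (1 + x ^ 2) - 1 / (1 + (N / 2) ^ 2) else 0

theorem mem_Icc_neg_iff_inv_one_add_sq_le {b x : ℝ} (hb : 0 ≤ b) :
    x ∈ Set.Icc (-b) b ↔ 1 / (1 + b ^ 2) ≤ 1 / (1 + x ^ 2) := by
  rw [one_div_le_one_div (by positivity) (by positivity), add_le_add_iff_left, sq_le_sq,
    abs_of_nonneg hb, abs_le, Set.mem_Icc]

theorem pN_eq_max {N : ℝ} (hN : 0 < N) (x : ℝ) :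
    pN N x = max (1 / (1 + x ^ 2) - 1 / (1 + (N / 2) ^ 2)) 0 := by
  have h := mem_Icc_neg_iff_inv_one_add_sq_le (x := x) (half_pos hN).le
  unfold pN
  split_ifs with hx
  · rw [max_eq_left (sub_nonneg.2 (h.1 hx))]
  · rw [max_eq_right (sub_nonpos.2 (not_le.1 (mt h.2 hx)).le)]

theorem pN_nonneg {N : ℝ} (hN : 0 < N) (x : ℝ) : 0 ≤ pN N x := by
  rw [pN_eq_max hN]
  exact le_max_right _ _

theorem continuous_pN {N : ℝ} (hN : 0 < N) : Continuous (pN N) := by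
  rw [funext (pN_eq_max hN)]
  have h : ∀ x : ℝ, 1 + x ^ 2 ≠ 0 := fun x => by positivity
  fun_prop (disch := exact h _)

theorem support_pN {N : ℝ} (hN : 0 < N) :
    Function.support (pN N) = Set.Ioo (-(N / 2)) (N / 2) := by
  ext x
  rw [Function.mem_support, ← (pN_nonneg hN x).lt_iff_ne', pN_eq_max hN, lt_max_iff,
    or_iff_left (lt_irrefl _), sub_pos, one_div_lt_one_div (by positivity) (by positivity),
    add_lt_add_iff_left, sq_lt_sq, abs_of_pos (half_pos hN), abs_lt, Set.mem_Ioo]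

theorem tsupport_pN {N : ℝ} (hN : 0 < N) :
    tsupport (pN N) = Set.Icc (-(N / 2)) (N / 2) := by
  rw [tsupport, support_pN hN, closure_Ioo (by linarith)]

theorem pN_neg {N : ℝ} (hN : 0 < N) (x : ℝ) : pN N (-x) = pN N x := by
  rw [pN_eq_max hN, pN_eq_max hN, neg_sq]

theorem strictMonoOn_pN {N : ℝ} (hN : 0 < N) :
    StrictMonoOn (pN N) (Set.Icc (-(N / 2)) 0) := by
  intro x hx y hy hxy
  have hsub : Set.Icc (-(N / 2)) 0 ⊆ Set.Icc (-(N / 2)) (N / 2) :=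
    Set.Icc_subset_Icc_right (half_pos hN).le
  rw [pN, pN, if_pos (hsub hx), if_pos (hsub hy)]
  refine sub_lt_sub_right (one_div_lt_one_div_of_lt (by positivity) ?_) _
  nlinarith [hx.2, hy.2]

/-- If `b² + x² ≤ 2 y²`, then the truncated bump at height `b` satisfies `2 p(y) ≤ p(x)`. -/
theorem two_mul_bump_le {b x y : ℝ} (h : b ^ 2 + x ^ 2 ≤ 2 * y ^ 2) :
    2 * (1 / (1 + y ^ 2) - 1 / (1 + b ^ 2)) ≤ 1 / (1 + x ^ 2) - 1 / (1 + b ^ 2) := by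
  have key : 1 / (1 + x ^ 2) - 1 / (1 + b ^ 2) - 2 * (1 / (1 + y ^ 2) - 1 / (1 + b ^ 2)) =
      ((2 * y ^ 2 - b ^ 2 - x ^ 2) + ((b ^ 2 + x ^ 2) * y ^ 2 - 2 * b ^ 2 * x ^ 2)) /
        ((1 + x ^ 2) * (1 + y ^ 2) * (1 + b ^ 2)) := by
    field_simp
    ring
  have hnum : 0 ≤ (b ^ 2 + x ^ 2) * y ^ 2 - 2 * b ^ 2 * x ^ 2 := by
    nlinarith [mul_le_mul_of_nonneg_left h (by positivity : 0 ≤ b ^ 2 + x ^ 2),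
      sq_nonneg (b ^ 2 - x ^ 2)]
  rw [← sub_nonneg, key]
  exact div_nonneg (by linarith) (by positivity)

theorem Delta2_pN_nonneg {N a x : ℝ} (hN : 0 < N) (ha : 3 * N / 7 ≤ a) (haN : a < N)
    (hx : x ∈ Set.Icc (-(N / 2)) (-(N / 4) + 3 * a / 4)) : 0 ≤ Delta2 a (pN N) x := by
  obtain ⟨hx1, hx2⟩ := hx
  have h1 := pN_nonneg hN (x - 2 * a)
  suffices 2 * pN N (x - a) ≤ pN N x by
    unfold Delta2
    linarith
  by_cases hy : x - a ∈ Set.Icc (-(N / 2)) (N / 2)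
  · have hx3 : x ∈ Set.Icc (-(N / 2)) (N / 2) := ⟨hx1, by linarith⟩
    rw [pN, pN, if_pos hy, if_pos hx3]
    apply two_mul_bump_le
    have hd : 0 ≤ -(N / 4) + 3 * a / 4 - x := by linarith
    have hprod : 0 ≤ (7 * a - 3 * N) * (N - a) := mul_nonneg (by linarith) (by linarith)
    have hmono : 0 ≤ (-(N / 4) + 3 * a / 4 - x) * (a - x + (N / 4 + a / 4) + 2 * a) :=
      mul_nonneg hd (by linarith)
    nlinarith
  · have h0 : pN N (x - a) = 0 := if_neg hy
    rw [h0, mul_zero]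
    exact pN_nonneg hN x

theorem stmt17 (N : ℝ) (hNpos : 0 < N) :
    ∀ a : ℝ, 3 * N / 7 ≤ a → a < N →
      (∀ x ∈ Set.Icc (-(N / 2)) (-(N / 4) + 3 * a / 4), 0 ≤ Delta2 a (pN N) x) ∧
      memV N a (pN N) := by
  intro a ha haN
  have hD : ∀ x ∈ Set.Icc (-(N / 2)) (-(N / 4) + 3 * a / 4), 0 ≤ Delta2 a (pN N) x :=
    fun x hx => Delta2_pN_nonneg hNpos ha haN hx
  refine ⟨hD, continuous_pN hNpos, tsupport_pN hNpos, pN_neg hNpos, strictMonoOn_pN hNpos,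
    fun _ => hD, fun _ => ⟨fun x hx => hD x ⟨hx.1, by linarith [hx.2]⟩, hD _ ⟨?_, le_rfl⟩⟩⟩
  linarith
end
end

section
/- Let N > 0 and define g_N(x) = e^{-x²} - e^{-N²/4} for x ∈ [-N/2, N/2] and g_N(x) = 0 otherwise. Then for every a with 3N/7 ≤ a < N one has g_N(x) - 2·g_N(x - a) ≥ 0 for every x ∈ (-N/2 + a, -N/4 + 3a/4], and Δ²_a g_N(x) ≥ 0 for every x ∈ [-N/2, -N/4 + 3a/4]; consequently g_N ∈ V_{N,a} for every a ∈ [3N/7, N). -/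
open Set

noncomputable section

/-- `g_N(x) = e^{-x²} - e^{-N²/4}` on `[-N/2, N/2]`, extended by zero. -/
def gN (N : ℝ) (x : ℝ) : ℝ :=
  if x ∈ Set.Icc (-(N / 2)) (N / 2) then Real.exp (-x ^ 2) - Real.exp (-(N ^ 2 / 4)) else 0

theorem gN_eq_max {N : ℝ} (hN : 0 < N) (x : ℝ) :
    gN N x = max (Real.exp (-x ^ 2) - Real.exp (-(N ^ 2 / 4))) 0 := by
  unfold gN
  split_ifs with h
  · rw [max_eq_left]
    rw [sub_nonneg, Real.exp_le_exp]
    nlinarith [mul_nonneg (sub_nonneg.2 h.1) (sub_nonneg.2 h.2)]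
  · rw [max_eq_right]
    rw [sub_nonpos, Real.exp_le_exp]
    by_cases h1 : -(N / 2) ≤ x
    · have h2 : N / 2 < x := not_le.1 fun h2 => h ⟨h1, h2⟩
      nlinarith
    · nlinarith

theorem gN_nonneg {N : ℝ} (hN : 0 < N) (x : ℝ) : 0 ≤ gN N x := by
  rw [gN_eq_max hN]
  exact le_max_right _ _

theorem gN_of_mem {N x : ℝ} (h : x ∈ Set.Icc (-(N / 2)) (N / 2)) :
    gN N x = Real.exp (-x ^ 2) - Real.exp (-(N ^ 2 / 4)) :=
  if_pos h

theorem gN_eq_zero_of_le {N x : ℝ} (hN : 0 < N) (h : x ≤ -(N / 2)) : gN N x = 0 := by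
  rw [gN_eq_max hN, max_eq_right]
  rw [sub_nonpos, Real.exp_le_exp]
  nlinarith

theorem support_gN {N : ℝ} (hN : 0 < N) :
    Function.support (gN N) = Set.Ioo (-(N / 2)) (N / 2) := by
  ext x
  rw [Function.mem_support, ← (gN_nonneg hN x).lt_iff_ne', gN_eq_max hN, lt_max_iff]
  simp only [lt_irrefl, or_false, sub_pos, Real.exp_lt_exp, Set.mem_Ioo]
  rw [← abs_lt, neg_lt_neg_iff, show N ^ 2 / 4 = (N / 2) ^ 2 by ring, sq_lt_sq,
    abs_of_pos (half_pos hN)]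

/-- Arithmetic-geometric mean inequality for exponentials. -/
theorem two_mul_exp_neg_le {s t y : ℝ} (h : s + t ≤ 2 * y) :
    2 * Real.exp (-y) ≤ Real.exp (-s) + Real.exp (-t) := by
  have h1 : Real.exp (-y) ≤ Real.exp (-s / 2) * Real.exp (-t / 2) := by
    rw [← Real.exp_add, Real.exp_le_exp]
    linarith
  have h2 : Real.exp (-s) = Real.exp (-s / 2) ^ 2 := by
    rw [← Real.exp_nat_mul]; congr 1; push_cast; ring
  have h3 : Real.exp (-t) = Real.exp (-t / 2) ^ 2 := by
    rw [← Real.exp_nat_mul]; congr 1; push_cast; ring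
  rw [h2, h3]
  nlinarith [sq_nonneg (Real.exp (-s / 2) - Real.exp (-t / 2))]

theorem gN_sub_two_mul_gN_nonneg {N a x : ℝ} (ha : 3 * N / 7 ≤ a) (haN : a < N)
    (hx : x ∈ Set.Ioc (-(N / 2) + a) (-(N / 4) + 3 * a / 4)) :
    0 ≤ gN N x - 2 * gN N (x - a) := by
  obtain ⟨h1, h2⟩ := hx
  rw [gN_of_mem ⟨by linarith, by linarith⟩, gN_of_mem ⟨by linarith, by linarith⟩]
  have hsq : x ^ 2 + N ^ 2 / 4 ≤ 2 * (x - a) ^ 2 := by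
    have hend : 0 ≤ (7 * a - 3 * N) * (N - a) :=
      mul_nonneg (by linarith) (by linarith)
    have hmono : 0 ≤ (-(N / 4) + 3 * a / 4 - x) * (4 * a - x - (-(N / 4) + 3 * a / 4)) :=
      mul_nonneg (by linarith) (by linarith)
    nlinarith
  linarith [two_mul_exp_neg_le hsq]

theorem Delta2_gN_nonneg {N a x : ℝ} (hN : 0 < N) (ha : 3 * N / 7 ≤ a) (haN : a < N)
    (hx : x ≤ -(N / 4) + 3 * a / 4) : 0 ≤ Delta2 a (gN N) x := by
  unfold Delta2
  have h2 := gN_nonneg hN (x - 2 * a)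
  rcases le_or_gt x (-(N / 2) + a) with h | h
  · rw [gN_eq_zero_of_le hN (by linarith : x - a ≤ -(N / 2))]
    linarith [gN_nonneg hN x]
  · linarith [gN_sub_two_mul_gN_nonneg ha haN ⟨h, hx⟩]

theorem strictMonoOn_gN {N : ℝ} (hN : 0 < N) :
    StrictMonoOn (gN N) (Set.Icc (-(N / 2)) 0) := by
  intro x hx y hy hxy
  rw [gN_of_mem ⟨hx.1, by linarith [hx.2]⟩, gN_of_mem ⟨hy.1, by linarith [hy.2]⟩,
    sub_lt_sub_iff_right, Real.exp_lt_exp]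
  nlinarith [hy.2]

theorem stmt19 (N : ℝ) (hNpos : 0 < N) :
    ∀ a : ℝ, 3 * N / 7 ≤ a → a < N →
      (∀ x ∈ Set.Ioc (-(N / 2) + a) (-(N / 4) + 3 * a / 4),
        0 ≤ gN N x - 2 * gN N (x - a)) ∧
      (∀ x ∈ Set.Icc (-(N / 2)) (-(N / 4) + 3 * a / 4), 0 ≤ Delta2 a (gN N) x) ∧
      memV N a (gN N) := by
  intro a ha haN
  refine ⟨fun x hx => gN_sub_two_mul_gN_nonneg ha haN hx,
    fun x hx => Delta2_gN_nonneg hNpos ha haN hx.2, ?_, ?_, ?_, strictMonoOn_gN hNpos,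
    fun _ x hx => Delta2_gN_nonneg hNpos ha haN hx.2,
    fun _ => ⟨fun x hx => Delta2_gN_nonneg hNpos ha haN (by linarith [hx.2]),
      Delta2_gN_nonneg hNpos ha haN le_rfl⟩⟩
  · rw [funext (gN_eq_max hNpos)]
    fun_prop
  · rw [tsupport, support_gN hNpos, closure_Ioo (by linarith)]
  · intro x
    simp only [gN_eq_max hNpos, neg_sq]
end
end
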